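/- arXiv:1211.2121 — 4 statements merged into one kernel-verified Lean document; each statement's English description precedes it below -/
import Mathlib

section
/- Fix d ∈ ℕ and K > 0. For σ > 0 let 𝒢_σ be the set of restrictions to [0,1]^d of functions that are analytic on the strip S_σ = {z ∈ ℂ^d : |Im z_j| ≤ σ for all j} and bounded in modulus by Kσ^{−d} on S_σ. Then there exist ε₀, σ₀ > 0 and constants K₁, K₂, K₃ > 0, not depending on ε or σ, such that: (i) for all ε ∈ (0,ε₀) and σ ∈ (0,σ₀), log N(ε, 𝒢_σ, ‖·‖_∞) ≤ K₁ σ^{−d} (log(K₂/(εσ^d)))^{1+d}; and (ii) for all ε ∈ (0,ε₀) and all σ > σ₀, log N(ε, 𝒢_σ, ‖·‖_∞) ≤ K₃ (log(1/ε))^{1+d}. Here ‖·‖_∞ is the supremum norm on [0,1]^d. -/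
open MeasureTheory Filter Set
open scoped ENNReal NNReal Topology Real

noncomputable section

/-- The strip `{z ∈ ℂ^d : |Im z_j| ≤ σ}`. -/
def strip (d : ℕ) (σ : ℝ) : Set (Fin d → ℂ) := {z | ∀ j, |(z j).im| ≤ σ}

/-- The unit cube `[0,1]^d`. -/
def cube (d : ℕ) : Set (Fin d → ℝ) := Set.Icc 0 1

/-- The class `𝒢_σ` of restrictions to `[0,1]^d` of functions analytic on the strip
`S_σ` and bounded in modulus by `K σ^{-d}` there. -/
def Gclass (d : ℕ) (K σ : ℝ) : Set ((Fin d → ℝ) → ℝ) :=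
  {f | ∃ F : (Fin d → ℂ) → ℂ, AnalyticOnNhd ℂ F (strip d σ) ∧
    (∀ z ∈ strip d σ, ‖F z‖ ≤ K / σ ^ d) ∧
    ∀ x ∈ cube d, F (fun j => (x j : ℂ)) = (f x : ℂ)}

/-- `log N(ε, B, ‖·‖_∞) ≤ A` for the supremum norm over `[0,1]^d`: there is a finite
set of functions of cardinality at most `e^A` such that every member of `B` is within
uniform distance `ε` of one of them. -/
def entropyLE (d : ℕ) (ε : ℝ) (B : Set ((Fin d → ℝ) → ℝ)) (A : ℝ) : Prop :=
  ∃ T : Finset ((Fin d → ℝ) → ℝ), (T.card : ℝ) ≤ Real.exp A ∧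
    ∀ f ∈ B, ∃ f' ∈ T, ∀ x ∈ cube d, |f x - f' x| ≤ ε

/-- Polynomials of degree less than `m` are recovered from their values at the `m`-th roots of
unity, scaled by `r`, with weights of modulus at most one on the disc of radius `r`. -/
theorem exists_interpolation_weights {m : ℕ} (hm : m ≠ 0) {r : ℝ} (hr : 0 < r) :
    ∃ (ξ : Fin m → ℂ) (w : Fin m → ℂ → ℂ), (∀ k, ‖ξ k‖ ≤ r) ∧
      (∀ k z, ‖z‖ ≤ r → ‖w k z‖ ≤ 1) ∧
      ∀ i < m, ∀ z, ∑ k, w k z * ξ k ^ i = z ^ i := by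
  obtain ⟨ζ, hζ⟩ : ∃ ζ : ℂ, IsPrimitiveRoot ζ m := ⟨_, Complex.isPrimitiveRoot_exp m hm⟩
  have hn : ‖ζ‖ = 1 := hζ.norm'_eq_one hm
  have hζ0 : ζ ≠ 0 := hζ.ne_zero hm
  have hr' : (r : ℂ) ≠ 0 := by exact_mod_cast hr.ne'
  have hm' : (m : ℂ) ≠ 0 := by exact_mod_cast hm
  have hm0 : (0 : ℝ) < m := by positivity
  refine ⟨fun k => r * ζ ^ (k : ℕ),
    fun k z => (m : ℂ)⁻¹ * ∑ j ∈ Finset.range m, (z / (r * ζ ^ (k : ℕ))) ^ j, ?_, ?_, ?_⟩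
  · intro k
    simp [hn, abs_of_pos hr]
  · intro k z hz
    rw [norm_mul, norm_inv, Complex.norm_natCast, inv_mul_le_iff₀ hm0, mul_one]
    refine (norm_sum_le _ _).trans ?_
    calc _ ≤ ∑ j ∈ Finset.range m, (1 : ℝ) := Finset.sum_le_sum fun j _ => by
          rw [norm_pow]
          refine pow_le_one₀ (norm_nonneg _) ?_
          rw [norm_div, norm_mul, norm_pow, hn, Complex.norm_real, Real.norm_of_nonneg hr.le]
          rw [one_pow, mul_one]
          exact div_le_one_of_le₀ hz hr.le
      _ = m := by simp
  · intro i hi z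
    have horth : ∀ j < m, ∑ k : Fin m, (ζ ^ i / ζ ^ j) ^ (k : ℕ) = if j = i then (m : ℂ) else 0 := by
      intro j hj
      rw [Fin.sum_univ_eq_sum_range (fun k => (ζ ^ i / ζ ^ j) ^ k) m]
      split_ifs with h
      · simp [h, hζ0]
      · have hq : ζ ^ i / ζ ^ j ≠ 1 := by
          intro hq
          rw [div_eq_one_iff_eq (pow_ne_zero _ hζ0)] at hq
          exact h (hζ.pow_inj hj hi hq.symm)
        rw [geom_sum_eq hq, div_pow, ← pow_mul, ← pow_mul, mul_comm i, mul_comm j, pow_mul, pow_mul,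
          hζ.pow_eq_one]
        simp
    calc ∑ k : Fin m, (m : ℂ)⁻¹ * (∑ j ∈ Finset.range m, (z / (r * ζ ^ (k : ℕ))) ^ j) *
          (r * ζ ^ (k : ℕ)) ^ i
        = ∑ j ∈ Finset.range m, (m : ℂ)⁻¹ * (z ^ j * (r ^ i / r ^ j)) *
            ∑ k : Fin m, (ζ ^ i / ζ ^ j) ^ (k : ℕ) := by
          simp_rw [Finset.mul_sum, Finset.sum_mul]
          rw [Finset.sum_comm]
          refine Finset.sum_congr rfl fun j _ => Finset.sum_congr rfl fun k _ => ?_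
          simp only [div_pow, mul_pow, ← pow_mul, mul_comm (k : ℕ)]
          field_simp
      _ = ∑ j ∈ Finset.range m, (m : ℂ)⁻¹ * (z ^ j * (r ^ i / r ^ j)) *
            if j = i then (m : ℂ) else 0 :=
          Finset.sum_congr rfl fun j hj => by rw [horth j (Finset.mem_range.1 hj)]
      _ = z ^ i := by
          simp [hi, hr', hm', mul_comm]

/-- The interpolation error of a function that is analytic and bounded by `M` on a disc whose
radius is four times that of the disc of the nodes. -/
theorem interpolation_error {m : ℕ} {r M : ℝ} (hr : 0 < r) {ξ : Fin m → ℂ}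
    {w : Fin m → ℂ → ℂ} (hξ : ∀ k, ‖ξ k‖ ≤ r) (hw : ∀ k z, ‖z‖ ≤ r → ‖w k z‖ ≤ 1)
    (hrep : ∀ i < m, ∀ z, ∑ k, w k z * ξ k ^ i = z ^ i) {f : ℂ → ℂ}
    (hf : ∀ z, ‖z‖ ≤ 4 * r → DifferentiableAt ℂ f z) (hM : ∀ z, ‖z‖ ≤ 4 * r → ‖f z‖ ≤ M)
    {z : ℂ} (hz : ‖z‖ ≤ r) :
    ‖f z - ∑ k, w k z * f (ξ k)‖ ≤ (m + 1) * (2 * M * (1 / 4) ^ m) := by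
  have hM0 : 0 ≤ M := (norm_nonneg _).trans (hM 0 (by simp; linarith))
  set a : ℕ → ℂ := fun n => (n.factorial : ℂ)⁻¹ * iteratedDeriv n f 0 with ha
  have hdc : DiffContOnCl ℂ f (Metric.ball 0 (4 * r)) := by
    refine DifferentiableOn.diffContOnCl fun z hz => (hf z ?_).differentiableWithinAt
    rw [closure_ball _ (by positivity)] at hz
    simpa using hz
  have hbound : ∀ n, ‖a n‖ ≤ M / (4 * r) ^ n := by
    intro n
    have := Complex.norm_iteratedDeriv_le_of_forall_mem_sphere_norm_le n (by positivity) hdc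
      (C := M) fun z hz => hM z (by simpa using (mem_sphere_zero_iff_norm.1 hz).le)
    rw [ha, norm_mul, norm_inv, Complex.norm_natCast, inv_mul_le_iff₀ (by positivity)]
    rwa [mul_div_assoc] at this
  have hsum : ∀ z, ‖z‖ ≤ r → HasSum (fun n => a n * z ^ n) (f z) := by
    intro z hz
    have h := Complex.hasSum_taylorSeries_on_ball (f := f) (c := 0) (r := 4 * r) (z := z)
      (hdc.differentiableOn) (by simp; linarith)
    simpa [ha, smul_eq_mul, mul_assoc, mul_comm, mul_left_comm] using h
  have htail : ∀ z, ‖z‖ ≤ r →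
      ‖f z - ∑ i ∈ Finset.range m, a i * z ^ i‖ ≤ 2 * M * (1 / 4) ^ m := by
    intro z hz
    have h1 := (hasSum_nat_add_iff' m).2 (hsum z hz)
    have h2 : HasSum (fun n : ℕ => M * (1 / 4) ^ m * (1 / 4 : ℝ) ^ n)
        (M * (1 / 4) ^ m * (1 - 1 / 4)⁻¹) :=
      (hasSum_geometric_of_lt_one (by norm_num) (by norm_num)).mul_left _
    refine (h1.norm_le_of_bounded h2 fun n => ?_).trans ?_
    · rw [norm_mul, norm_pow, mul_assoc, ← pow_add, add_comm m]
      calc ‖a (n + m)‖ * ‖z‖ ^ (n + m) ≤ M / (4 * r) ^ (n + m) * r ^ (n + m) := by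
            gcongr; exact hbound _
        _ = _ := by rw [mul_pow, one_div, inv_pow]; field_simp
    · have : 0 ≤ M * (1 / 4 : ℝ) ^ m := by positivity
      rw [show (1 - 1 / 4 : ℝ)⁻¹ = 4 / 3 by norm_num]
      linarith
  have hpoly : ∑ k, w k z * ∑ i ∈ Finset.range m, a i * ξ k ^ i
      = ∑ i ∈ Finset.range m, a i * z ^ i := by
    simp_rw [Finset.mul_sum]
    rw [Finset.sum_comm]
    refine Finset.sum_congr rfl fun i hi => ?_
    rw [← hrep i (Finset.mem_range.1 hi) z, Finset.mul_sum]
    exact Finset.sum_congr rfl fun k _ => by ring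
  set P : ℂ → ℂ := fun z => ∑ i ∈ Finset.range m, a i * z ^ i with hP
  have hsplit : f z - ∑ k, w k z * f (ξ k) = (f z - P z) - ∑ k, w k z * (f (ξ k) - P (ξ k)) := by
    simp_rw [mul_sub, Finset.sum_sub_distrib]
    rw [show ∑ k, w k z * P (ξ k) = P z from hpoly]
    ring
  rw [hsplit]
  calc _ ≤ ‖f z - P z‖ + ∑ k, ‖w k z * (f (ξ k) - P (ξ k))‖ :=
        (norm_sub_le _ _).trans (by gcongr; exact norm_sum_le _ _)
    _ ≤ 2 * M * (1 / 4) ^ m + ∑ k : Fin m, 2 * M * (1 / 4) ^ m := by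
        gcongr with k
        · exact htail z hz
        · rw [norm_mul]
          exact (mul_le_of_le_one_left (norm_nonneg _) (hw k z hz)).trans (htail _ (hξ k))
    _ = _ := by simp; ring

/-- A one-variable interpolation error bound `E` yields an error bound for the tensor product rule
in `d` variables. -/
theorem tensor_interpolation_error {m : ℕ} {r M E : ℝ} (hr : 0 < r) (hm : m ≠ 0)
    {ξ : Fin m → ℂ}
    {w : Fin m → ℂ → ℂ} (hξ : ∀ k, ‖ξ k‖ ≤ r) (hw : ∀ k z, ‖z‖ ≤ r → ‖w k z‖ ≤ 1)
    (hE : ∀ f : ℂ → ℂ, (∀ z, ‖z‖ ≤ 4 * r → DifferentiableAt ℂ f z) →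
      (∀ z, ‖z‖ ≤ 4 * r → ‖f z‖ ≤ M) → ∀ z, ‖z‖ ≤ r → ‖f z - ∑ k, w k z * f (ξ k)‖ ≤ E)
    (hE0 : 0 ≤ E) {d : ℕ}
    {G : (Fin d → ℂ) → ℂ} (hG : ∀ z, (∀ j, ‖z j‖ ≤ 4 * r) → DifferentiableAt ℂ G z)
    (hM : ∀ z, (∀ j, ‖z j‖ ≤ 4 * r) → ‖G z‖ ≤ M) {z : Fin d → ℂ} (hz : ∀ j, ‖z j‖ ≤ r) :
    ‖G z - ∑ α : Fin d → Fin m, (∏ j, w (α j) (z j)) * G (fun j => ξ (α j))‖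
      ≤ d * m ^ d * E := by
  induction d with
  | zero => simp [Subsingleton.elim z (fun j => ξ ((default : Fin 0 → Fin m) j))]
  | succ d ih =>
    have hcons : ∀ {z₀ : ℂ} {y : Fin d → ℂ}, ‖z₀‖ ≤ 4 * r → (∀ j, ‖y j‖ ≤ 4 * r) →
        ∀ j, ‖(Fin.cons z₀ y : Fin (d + 1) → ℂ) j‖ ≤ 4 * r :=
      fun h0 hy j => Fin.cases h0 hy j
    have hr4 : ∀ {x : ℝ}, x ≤ r → x ≤ 4 * r := fun h => by linarith
    have h1 := ih (G := fun y => G (Fin.cons (z 0) y)) (z := Fin.tail z)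
      (fun y hy => (hG _ (hcons (hr4 (hz 0)) hy)).comp y <| by
        rw [differentiableAt_pi]
        exact fun j => Fin.cases (by simp) (fun j => by simp; fun_prop) j)
      (fun y hy => hM _ (hcons (hr4 (hz 0)) hy)) (fun j => hz j.succ)
    have h2 : ∀ α : Fin d → Fin m, ‖G (Fin.cons (z 0) fun j => ξ (α j)) -
        ∑ k, w k (z 0) * G (Fin.cons (ξ k) fun j => ξ (α j))‖ ≤ E := fun α =>
      hE (fun t => G (Fin.cons t fun j => ξ (α j)))
        (fun t ht => (hG _ (hcons ht fun j => hr4 (hξ _))).comp t <| by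
          rw [differentiableAt_pi]
          exact fun j => Fin.cases (by simp) (fun j => by simp) j)
        (fun t ht => hM _ (hcons ht fun j => hr4 (hξ _))) (z 0) (hz 0)
    have hsum : ∑ α : Fin (d + 1) → Fin m, (∏ j, w (α j) (z j)) * G (fun j => ξ (α j)) =
        ∑ α : Fin d → Fin m, (∏ j, w (α j) (Fin.tail z j)) *
          ∑ k, w k (z 0) * G (Fin.cons (ξ k) fun j => ξ (α j)) := by
      rw [← (Fin.consEquiv fun _ => Fin m).sum_comp, Fintype.sum_prod_type, Finset.sum_comm]
      refine Finset.sum_congr rfl fun α _ => ?_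
      rw [Finset.mul_sum]
      refine Finset.sum_congr rfl fun k _ => ?_
      rw [Fin.prod_univ_succ]
      have : (fun j => ξ ((Fin.consEquiv fun _ => Fin m) (k, α) j)) =
          (Fin.cons (ξ k) fun j => ξ (α j) : Fin (d + 1) → ℂ) := by
        funext j
        exact Fin.cases (by simp [Fin.consEquiv]) (fun j => by simp [Fin.consEquiv]) j
      rw [this]
      simp [Fin.consEquiv, Fin.tail]
      ring
    have hz' : (Fin.cons (z 0) (Fin.tail z) : Fin (d + 1) → ℂ) = z := Fin.cons_self_tail z
    rw [hsum]
    have hw1 : ∀ α : Fin d → Fin m, ‖∏ j, w (α j) (Fin.tail z j)‖ ≤ 1 := fun α => by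
      rw [norm_prod]
      exact Finset.prod_le_one (fun _ _ => norm_nonneg _) fun j _ => hw _ _ (hz j.succ)
    have h3 : ‖∑ α : Fin d → Fin m, (∏ j, w (α j) (Fin.tail z j)) *
        (G (Fin.cons (z 0) fun j => ξ (α j)) -
          ∑ k, w k (z 0) * G (Fin.cons (ξ k) fun j => ξ (α j)))‖ ≤ m ^ d * E := by
      refine (norm_sum_le _ _).trans ?_
      calc _ ≤ ∑ α : Fin d → Fin m, E := Finset.sum_le_sum fun α _ => by
            rw [norm_mul]
            exact (mul_le_of_le_one_left (norm_nonneg _) (hw1 α)).trans (h2 α)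
        _ = _ := by simp
    have hm1 : (1 : ℝ) ≤ m := by exact_mod_cast Nat.one_le_iff_ne_zero.2 hm
    have hpow : (m : ℝ) ^ d ≤ m ^ (d + 1) := pow_le_pow_right₀ hm1 (Nat.le_succ d)
    simp_rw [mul_sub, Finset.sum_sub_distrib] at h3
    simp only [hz'] at h1
    calc _ ≤ _ := norm_sub_le_norm_sub_add_norm_sub _
          (∑ α : Fin d → Fin m, (∏ j, w (α j) (Fin.tail z j)) *
            G (Fin.cons (z 0) fun j => ξ (α j))) _
      _ ≤ d * m ^ d * E + m ^ d * E := add_le_add h1 h3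
      _ = (d + 1) * m ^ d * E := by ring
      _ ≤ _ := by push_cast; gcongr

/-- A square grid of mesh `δ` in the disc of radius `M`. -/
theorem exists_finset_grid {M δ : ℝ} (hM : 0 ≤ M) (hδ : 0 < δ) :
    ∃ S : Finset ℂ, (S.card : ℝ) ≤ (2 * (M / δ) + 5) ^ 2 ∧
      ∀ v : ℂ, ‖v‖ ≤ M → ∃ s ∈ S, ‖v - s‖ ≤ 2 * δ := by
  set N : ℤ := ⌈M / δ⌉ + 1 with hN
  have hN0 : 0 ≤ N := by positivity
  refine ⟨(Finset.Icc (-N) N ×ˢ Finset.Icc (-N) N).image fun p : ℤ × ℤ => ⟨δ * p.1, δ * p.2⟩, ?_, ?_⟩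
  · have h1 : (((Finset.Icc (-N) N).card : ℤ) : ℝ) ≤ 2 * (M / δ) + 5 := by
      rw [Int.card_Icc, Int.toNat_of_nonneg (by omega), hN]
      push_cast
      linarith [Int.ceil_lt_add_one (M / δ)]
    calc _ ≤ (((Finset.Icc (-N) N ×ˢ Finset.Icc (-N) N).card : ℕ) : ℝ) := by
          exact_mod_cast Finset.card_image_le
      _ = ((Finset.Icc (-N) N).card : ℝ) ^ 2 := by rw [Finset.card_product]; push_cast; ring
      _ ≤ _ := by
          gcongr
          exact_mod_cast h1
  · intro v hv
    have hfl : ∀ t : ℝ, |t| ≤ M → ⌊t / δ⌋ ∈ Finset.Icc (-N) N ∧ |t - δ * ⌊t / δ⌋| ≤ δ := by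
      intro t ht
      have ht' := abs_le.1 ht
      have hl : ⌊t / δ⌋ ≤ t / δ := Int.floor_le _
      have hu := Int.lt_floor_add_one (t / δ)
      have hc := Int.le_ceil (M / δ)
      have hup : t / δ ≤ M / δ := by gcongr; exact ht'.2
      have hlo : -(M / δ) ≤ t / δ := by rw [← neg_div]; gcongr; exact ht'.1
      refine ⟨?_, ?_⟩
      · rw [Finset.mem_Icc]
        constructor
        · have : -(N : ℝ) ≤ ⌊t / δ⌋ := by rw [hN]; push_cast; linarith
          exact_mod_cast this
        · have : (⌊t / δ⌋ : ℝ) ≤ N := by rw [hN]; push_cast; linarith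
          exact_mod_cast this
      · have : t - δ * ⌊t / δ⌋ = δ * (t / δ - ⌊t / δ⌋) := by field_simp
        rw [this, abs_mul, abs_of_pos hδ]
        refine mul_le_of_le_one_right hδ.le (abs_le.2 ⟨?_, ?_⟩) <;> linarith
    have hre := hfl v.re ((Complex.abs_re_le_norm v).trans hv)
    have him := hfl v.im ((Complex.abs_im_le_norm v).trans hv)
    refine ⟨_, Finset.mem_image.2 ⟨(⌊v.re / δ⌋, ⌊v.im / δ⌋),
      Finset.mem_product.2 ⟨hre.1, him.1⟩, rfl⟩, ?_⟩
    refine (Complex.norm_le_abs_re_add_abs_im _).trans ?_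
    simp only [Complex.sub_re, Complex.sub_im]
    linarith [hre.2, him.2]

/-- Replacing each sampled value of an analytic function by a nearby element of a finite set `S`
covers the class of analytic functions on a strip that are bounded by `M`. -/
theorem exists_finset_cover_of_analytic {d m n : ℕ} {σ ε M δ : ℝ} (hσ : 0 < σ) (hn : 4 / σ ≤ n)
    (hm : m ≠ 0) (hM : 0 ≤ M)
    (herr : d * m ^ d * ((m + 1) * (2 * M * (1 / 4) ^ m)) ≤ ε / 2) {S : Finset ℂ}
    (hS : ∀ v : ℂ, ‖v‖ ≤ M → ∃ s ∈ S, ‖v - s‖ ≤ δ) (hδ : m ^ d * δ ≤ ε / 2) :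
    ∃ T : Finset ((Fin d → ℝ) → ℝ), T.card ≤ S.card ^ ((n + 1) ^ d * m ^ d) ∧
      ∀ (f : (Fin d → ℝ) → ℝ) (F : (Fin d → ℂ) → ℂ), AnalyticOnNhd ℂ F (strip d σ) →
        (∀ z ∈ strip d σ, ‖F z‖ ≤ M) → (∀ x ∈ cube d, F (fun j => (x j : ℂ)) = (f x : ℂ)) →
        ∃ f' ∈ T, ∀ x ∈ cube d, |f x - f' x| ≤ ε := by
  classical
  have hr : 0 < σ / 4 := by positivity
  have hn0 : (0 : ℝ) < n := lt_of_lt_of_le (by positivity) hn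
  obtain ⟨ξ, w, hξ, hw, hrep⟩ := exists_interpolation_weights hm hr
  set idx : (Fin d → ℝ) → Fin d → Fin (n + 1) := fun x j => Fin.ofNat (n + 1) ⌊n * x j⌋₊
  set c : (Fin d → Fin (n + 1)) → Fin d → ℝ := fun i j => (i j : ℕ) / n
  set approx : ((Fin d → Fin (n + 1)) → (Fin d → Fin m) → S) → (Fin d → ℝ) → ℝ := fun V x =>
    (∑ α : Fin d → Fin m, (∏ j, w (α j) ((x j - c (idx x) j : ℝ) : ℂ)) * V (idx x) α).re
  refine ⟨Finset.univ.image approx, ?_, ?_⟩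
  · refine Finset.card_image_le.trans (le_of_eq ?_)
    simp [← pow_mul, mul_comm]
  · intro f F hF hFM hfF
    have hmem : ∀ i (z : Fin d → ℂ), (∀ j, ‖z j‖ ≤ 4 * (σ / 4)) →
        (fun j => (c i j : ℂ) + z j) ∈ strip d σ := by
      intro i z hz j
      have := (Complex.abs_im_le_norm (z j)).trans (hz j)
      simp only [Complex.add_im, Complex.ofReal_im, zero_add]
      linarith
    have hval : ∀ i (α : Fin d → Fin m), ∃ s : S, ‖F (fun j => (c i j : ℂ) + ξ (α j)) - s‖ ≤ δ := by
      intro i α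
      obtain ⟨s, hs, h⟩ := hS _ (hFM _ (hmem i (fun j => ξ (α j)) fun j => by linarith [hξ (α j)]))
      exact ⟨⟨s, hs⟩, h⟩
    choose V hV using hval
    refine ⟨approx V, Finset.mem_image_of_mem _ (Finset.mem_univ _), fun x hx => ?_⟩
    set i := idx x with hi
    have hxc : ∀ j, |x j - c i j| ≤ σ / 4 := by
      intro j
      have hx0 : 0 ≤ x j := hx.1 j
      have hx1 : x j ≤ 1 := hx.2 j
      have hle : ⌊n * x j⌋₊ ≤ n :=
        Nat.floor_le_of_le (mul_le_of_le_one_right hn0.le hx1)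
      have hival : ((i j : ℕ) : ℝ) = ⌊n * x j⌋₊ := by
        simp [hi, idx, Nat.mod_eq_of_lt (Nat.lt_succ_of_le hle)]
      have h1 : (⌊n * x j⌋₊ : ℝ) ≤ n * x j := Nat.floor_le (by positivity)
      have h2 := Nat.lt_floor_add_one (n * x j)
      have h3 : x j - c i j = (n * x j - ⌊n * x j⌋₊) / n := by
        simp only [c, hival]
        field_simp
      rw [h3, abs_of_nonneg (div_nonneg (by linarith) hn0.le)]
      calc _ ≤ 1 / (n : ℝ) := by gcongr; linarith
        _ ≤ 1 / (4 / σ) := by gcongr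
        _ = σ / 4 := by field_simp
    have hy : ∀ j, ‖((x j - c i j : ℝ) : ℂ)‖ ≤ σ / 4 := fun j => by
      rw [Complex.norm_real]; exact hxc j
    have hE0 : 0 ≤ ((m : ℝ) + 1) * (2 * M * (1 / 4) ^ m) := by positivity
    have hT := tensor_interpolation_error hr hm hξ hw
      (fun g hg hgM z hz => interpolation_error hr hξ hw hrep hg hgM hz) hE0
      (G := fun z => F fun j => (c i j : ℂ) + z j) (M := M)
      (fun z hz => ((hF _ (hmem i z hz)).differentiableAt).comp z <| by fun_prop)
      (fun z hz => hFM _ (hmem i z hz)) hy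
    have hFx : F (fun j => (c i j : ℂ) + ((x j - c i j : ℝ) : ℂ)) = f x := by
      rw [← hfF x hx]
      congr 1
      funext j
      push_cast
      ring
    simp only [hFx] at hT
    have hq : ‖∑ α : Fin d → Fin m, (∏ j, w (α j) ((x j - c i j : ℝ) : ℂ)) *
        (F (fun j => (c i j : ℂ) + ξ (α j)) - V i α)‖ ≤ m ^ d * δ := by
      refine (norm_sum_le _ _).trans ?_
      calc _ ≤ ∑ α : Fin d → Fin m, δ := Finset.sum_le_sum fun α _ => by
            rw [norm_mul, norm_prod]
            exact (mul_le_of_le_one_left (norm_nonneg _) (Finset.prod_le_one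
              (fun _ _ => norm_nonneg _) fun j _ => hw _ _ (hy j))).trans (hV i α)
        _ = _ := by simp
    simp_rw [mul_sub, Finset.sum_sub_distrib] at hq
    set A := ∑ α : Fin d → Fin m, (∏ j, w (α j) ((x j - c i j : ℝ) : ℂ)) * V i α with hA
    have hre : f x - approx V x = ((f x : ℂ) - A).re := by simp [approx, hA, hi]
    rw [hre]
    calc _ ≤ ‖(f x : ℂ) - A‖ := Complex.abs_re_le_norm _
      _ ≤ _ := norm_sub_le_norm_sub_add_norm_sub _ _ _
      _ ≤ ε / 2 + ε / 2 := add_le_add (hT.trans herr) (hq.trans hδ)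
      _ = ε := add_halves ε

theorem exists_add_one_pow_le_mul_two_pow (k : ℕ) :
    ∃ C : ℝ, 0 < C ∧ ∀ m : ℕ, ((m : ℝ) + 1) ^ k ≤ C * 2 ^ m := by
  have h := tendsto_pow_const_mul_const_pow_of_abs_lt_one k (r := 1 / 2) (by norm_num [abs_of_pos])
  obtain ⟨C, hC⟩ := h.bddAbove_range
  refine ⟨2 * max C 1, by positivity, fun m => ?_⟩
  have h1 : ((m + 1 : ℕ) : ℝ) ^ k * (1 / 2) ^ (m + 1) ≤ max C 1 :=
    (hC ⟨m + 1, rfl⟩).trans (le_max_left _ _)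
  rw [one_div, inv_pow, ← div_eq_mul_inv, div_le_iff₀ (by positivity), pow_succ] at h1
  push_cast at h1
  linarith

theorem entropyLE_Gclass (d : ℕ) {K : ℝ} (hK : 0 < K) :
    ∃ K₁ K₂ : ℝ, 0 < K₁ ∧ Real.exp 1 ≤ K₂ ∧ ∀ ε ∈ Ioo (0 : ℝ) 1, ∀ σ ∈ Ioc (0 : ℝ) 1,
      entropyLE d ε (Gclass d K σ)
        (K₁ * (1 / σ ^ d) * Real.log (K₂ / (ε * σ ^ d)) ^ (1 + d)) := by
  obtain ⟨C, hC, hCm⟩ := exists_add_one_pow_le_mul_two_pow (d + 1)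
  set K₂ : ℝ := Real.exp 1 + 4 * d * C * K + 4 * C * K with hK₂
  have hK₂e : Real.exp 1 ≤ K₂ := by
    have : 0 ≤ 4 * d * C * K := by positivity
    have : 0 ≤ 4 * C * K := by positivity
    linarith
  have hK₂0 : 0 < K₂ := (Real.exp_pos 1).trans_le hK₂e
  refine ⟨12 * 18 ^ d, K₂, by positivity, hK₂e, ?_⟩
  rintro ε ⟨hε, hε1⟩ σ ⟨hσ, hσ1⟩
  have hσd : 0 < σ ^ d := by positivity
  have hq0 : 0 < ε * σ ^ d := by positivity
  have hq1 : ε * σ ^ d ≤ 1 := mul_le_one₀ hε1.le hσd.le (pow_le_one₀ hσ.le hσ1)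
  set L := Real.log (K₂ / (ε * σ ^ d)) with hL
  have hexpL : Real.exp L = K₂ / (ε * σ ^ d) := Real.exp_log (by positivity)
  have hL1 : 1 ≤ L := by
    rw [hL, Real.le_log_iff_exp_le (by positivity), le_div_iff₀ hq0]
    exact (mul_le_of_le_one_right (Real.exp_pos 1).le hq1).trans hK₂e
  set M := K / σ ^ d with hM
  have hM0 : 0 < M := by positivity
  set m := ⌈2 * L⌉₊ with hm
  have hmL : 2 * L ≤ m := Nat.le_ceil _
  have hmL' : (m : ℝ) ≤ 3 * L := by linarith [Nat.ceil_lt_add_one (show 0 ≤ 2 * L by linarith)]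
  have hmpos : (0 : ℝ) < m := by linarith
  have hm0 : m ≠ 0 := by exact_mod_cast hmpos.ne'
  have h2m : Real.exp L ≤ 2 ^ m := by
    rw [← Real.exp_log (show (0 : ℝ) < 2 ^ m by positivity), Real.exp_le_exp, Real.log_pow]
    nlinarith [Real.log_two_gt_d9]
  have h2m' : (2 : ℝ) ^ m ≤ Real.exp (3 * L) := by
    calc (2 : ℝ) ^ m ≤ Real.exp 1 ^ m := by gcongr; linarith [Real.exp_one_gt_d9]
      _ = Real.exp m := by rw [← Real.exp_nat_mul, mul_one]
      _ ≤ _ := Real.exp_le_exp.2 hmL'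
  have hdC : 4 * d * C * M ≤ ε * Real.exp L := by
    rw [hexpL, hM, hK₂]
    have : 0 ≤ Real.exp 1 + 4 * C * K := by positivity
    field_simp
    linarith
  have hCM : 4 * C * M ≤ ε * Real.exp L := by
    rw [hexpL, hM, hK₂]
    have : 0 ≤ Real.exp 1 + 4 * d * C * K := by positivity
    field_simp
    linarith
  have hmd : (m : ℝ) ^ d * (m + 1) ≤ C * 2 ^ m := by
    refine le_trans ?_ (hCm m)
    rw [pow_succ]
    gcongr
    linarith
  have hmd' : (m : ℝ) ^ d ≤ C * 2 ^ m :=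
    (le_mul_of_one_le_right (by positivity) (by linarith)).trans hmd
  have herr : d * (m : ℝ) ^ d * ((m + 1) * (2 * M * (1 / 4) ^ m)) ≤ ε / 2 := by
    have h4 : (1 / 4 : ℝ) ^ m = 1 / (2 ^ m * 2 ^ m) := by
      rw [← mul_pow, one_div_pow]; norm_num
    calc d * (m : ℝ) ^ d * ((m + 1) * (2 * M * (1 / 4) ^ m))
        = (m : ℝ) ^ d * (m + 1) * (2 * d * M * (1 / 4) ^ m) := by ring
      _ ≤ C * 2 ^ m * (2 * d * M * (1 / 4) ^ m) := by gcongr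
      _ = (4 * d * C * M) / (2 * 2 ^ m) := by rw [h4]; field_simp; ring
      _ ≤ (ε * 2 ^ m) / (2 * 2 ^ m) :=
          div_le_div_of_nonneg_right (hdC.trans (by gcongr)) (by positivity)
      _ = ε / 2 := by field_simp
  set δ := ε / (4 * (m : ℝ) ^ d) with hδ
  have hδ0 : 0 < δ := by positivity
  obtain ⟨S, hScard, hS⟩ := exists_finset_grid hM0.le hδ0
  have hMδ : M / δ ≤ Real.exp (4 * L) := by
    calc M / δ = 4 * M * m ^ d / ε := by rw [hδ]; field_simp
      _ ≤ 4 * M * (C * 2 ^ m) / ε := by gcongr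
      _ = 4 * C * M * 2 ^ m / ε := by ring
      _ ≤ ε * Real.exp L * Real.exp (3 * L) / ε := by gcongr
      _ = Real.exp (4 * L) := by
          rw [mul_assoc, mul_div_cancel_left₀ _ hε.ne', ← Real.exp_add]; ring_nf
  have hS' : (S.card : ℝ) ≤ Real.exp (12 * L) := by
    have h7 : 7 ≤ Real.exp (2 * L) := by
      calc (7 : ℝ) ≤ Real.exp 1 ^ 2 := by nlinarith [Real.exp_one_gt_d9]
        _ = Real.exp 2 := by rw [← Real.exp_nat_mul]; norm_num
        _ ≤ _ := Real.exp_le_exp.2 (by linarith)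
    have h1 : 1 ≤ Real.exp (4 * L) := Real.one_le_exp (by linarith)
    calc (S.card : ℝ) ≤ (2 * (M / δ) + 5) ^ 2 := hScard
      _ ≤ (Real.exp (2 * L) * Real.exp (4 * L)) ^ 2 := by gcongr; nlinarith
      _ = Real.exp (12 * L) := by rw [← Real.exp_add, ← Real.exp_nat_mul]; ring_nf
  obtain ⟨T, hTcard, hT⟩ := exists_finset_cover_of_analytic (d := d) (n := ⌈4 / σ⌉₊) (ε := ε)
    (δ := 2 * δ) hσ (Nat.le_ceil _) hm0 hM0.le herr hS
    (le_of_eq (by rw [hδ]; field_simp; norm_num))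
  refine ⟨T, ?_, fun f ⟨F, hF, hFM, hfF⟩ => hT f F hF hFM hfF⟩
  have hn : ((⌈4 / σ⌉₊ : ℝ) + 1) ≤ 6 / σ := by
    have h1 := Nat.ceil_lt_add_one (show 0 ≤ 4 / σ by positivity)
    have h2 : 1 ≤ 1 / σ := by rwa [le_div_iff₀ hσ, one_mul]
    have h3 : 6 / σ = 4 / σ + 2 * (1 / σ) := by ring
    linarith
  calc (T.card : ℝ) ≤ (S.card : ℝ) ^ ((⌈4 / σ⌉₊ + 1) ^ d * m ^ d) := by exact_mod_cast hTcard
    _ ≤ Real.exp (12 * L) ^ ((⌈4 / σ⌉₊ + 1) ^ d * m ^ d) := by gcongr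
    _ = Real.exp (((⌈4 / σ⌉₊ : ℝ) + 1) ^ d * m ^ d * (12 * L)) := by
        rw [← Real.exp_nat_mul]; push_cast; rfl
    _ ≤ Real.exp ((6 / σ) ^ d * (3 * L) ^ d * (12 * L)) := by gcongr
    _ = _ := by
        congr 1
        rw [show (18 : ℝ) = 6 * 3 by norm_num, mul_pow, mul_pow, div_pow, pow_add]
        ring

theorem Gclass_subset_of_le {d : ℕ} {K σ τ : ℝ} (hK : 0 ≤ K) (hσ : 0 < σ) (hστ : σ ≤ τ) :
    Gclass d K τ ⊆ Gclass d K σ := by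
  rintro f ⟨F, hF, hFM, hfF⟩
  have hsub : strip d σ ⊆ strip d τ := fun z hz j => (hz j).trans hστ
  exact ⟨F, hF.mono hsub, fun z hz => (hFM z (hsub hz)).trans (by gcongr), hfF⟩

theorem entropyLE.mono {d : ℕ} {ε A A' : ℝ} {B B' : Set ((Fin d → ℝ) → ℝ)}
    (h : entropyLE d ε B A) (hB : B' ⊆ B) (hA : A ≤ A') : entropyLE d ε B' A' := by
  obtain ⟨T, hTcard, hT⟩ := h
  exact ⟨T, hTcard.trans (Real.exp_le_exp.2 hA), fun f hf => hT f (hB hf)⟩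

/-- **Lemma 3.2 (case `γ = ∞`).** Metric entropy bounds for the classes `𝒢_σ` of
analytic functions on strips: there exist `ε₀, σ₀ > 0` and constants `K₁, K₂, K₃ > 0`
such that `log N(ε, 𝒢_σ, ‖·‖_∞) ≤ K₁ σ^{-d} (log(K₂/(εσ^d)))^{1+d}` for
`ε ∈ (0,ε₀)`, `σ ∈ (0,σ₀)`, and `log N(ε, 𝒢_σ, ‖·‖_∞) ≤ K₃ (log(1/ε))^{1+d}` for
`ε ∈ (0,ε₀)`, `σ > σ₀`. -/
theorem entropy_analytic_class (d : ℕ) (hd : 0 < d) (K : ℝ) (hK : 0 < K) :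
    ∃ ε₀ σ₀ K₁ K₂ K₃ : ℝ, 0 < ε₀ ∧ 0 < σ₀ ∧ 0 < K₁ ∧ 0 < K₂ ∧ 0 < K₃ ∧
      (∀ ε ∈ Set.Ioo (0 : ℝ) ε₀, ∀ σ ∈ Set.Ioo (0 : ℝ) σ₀,
        entropyLE d ε (Gclass d K σ)
          (K₁ * (1 / σ ^ d) * Real.log (K₂ / (ε * σ ^ d)) ^ (1 + d))) ∧
      (∀ ε ∈ Set.Ioo (0 : ℝ) ε₀, ∀ σ : ℝ, σ₀ < σ →
        entropyLE d ε (Gclass d K σ) (K₃ * Real.log (1 / ε) ^ (1 + d))) := by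
  obtain ⟨K₁, K₂, hK₁, hK₂, h⟩ := entropyLE_Gclass d hK
  have hlogK₂ : 0 ≤ Real.log K₂ :=
    Real.log_nonneg ((Real.one_le_exp zero_le_one).trans hK₂)
  have hlog2 : 0 < Real.log 2 := Real.log_pos one_lt_two
  have hK₂0 : 0 < K₂ := (Real.exp_pos 1).trans_le hK₂
  refine ⟨1 / 2, 1, K₁, K₂, K₁ * (Real.log K₂ / Real.log 2 + 1) ^ (1 + d), by norm_num, one_pos,
    hK₁, hK₂0, by positivity, ?_, ?_⟩
  · exact fun ε hε σ hσ => h ε ⟨hε.1, by linarith [hε.2]⟩ σ ⟨hσ.1, hσ.2.le⟩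
  · rintro ε ⟨hε, hε2⟩ σ hσ
    have hbound := h ε ⟨hε, by linarith⟩ 1 ⟨one_pos, le_rfl⟩
    refine hbound.mono (Gclass_subset_of_le hK.le one_pos hσ.le) ?_
    have hlogε : Real.log 2 ≤ Real.log (1 / ε) := by
      refine Real.log_le_log two_pos ?_
      rw [le_div_iff₀ hε]
      linarith
    have hlog : Real.log (K₂ / ε) = Real.log K₂ + Real.log (1 / ε) := by
      rw [← Real.log_mul hK₂0.ne' (by positivity), mul_one_div]
    have hle : Real.log (K₂ / ε) ≤ (Real.log K₂ / Real.log 2 + 1) * Real.log (1 / ε) := by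
      have : Real.log K₂ ≤ Real.log K₂ / Real.log 2 * Real.log (1 / ε) := by
        rw [div_mul_eq_mul_div, le_div_iff₀ hlog2]
        gcongr
      linarith
    have h0 : 0 ≤ Real.log (K₂ / ε) := by linarith
    rw [mul_assoc K₁ (_ ^ _), ← mul_pow]
    simp only [one_pow, mul_one, div_one]
    gcongr
end
end

section
/- Let p: ℝ^d → ℝ be integrable with ∫p(x)dx = 1 and with all absolute moments finite. Let α > 0 and let f ∈ C^α(ℝ^d). Then there exists a constant K₆ > 0, not depending on σ, such that for all σ > 0: sup_{x∈ℝ^d} |(p_σ * (T_{α,σ} f))(x) − f(x)| ≤ K₆ σ^α, where p_σ(x) = σ^{−d} p(x/σ) and * denotes convolution on ℝ^d. -/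
open MeasureTheory ProbabilityTheory Filter Set
open scoped ENNReal NNReal Topology Real

noncomputable section

/-- The degree `k. = k₁ + ⋯ + k_d` of a multi-index. -/
def mdeg {d : ℕ} (k : Fin d → ℕ) : ℕ := ∑ j, k j

/-- The largest integer strictly smaller than `α` (for `α > 0`). -/
def lint (α : ℝ) : ℕ := ⌈α⌉₊ - 1

/-- The Hölder class of order `α` on all of `ℝ^d`: bounded partial derivatives up to
order `β = lint α`, with the order-`β` derivatives Hölder continuous of order `α - β`. -/
def IsHolder (d : ℕ) (α : ℝ) (f : (Fin d → ℝ) → ℝ) : Prop :=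
  ContDiff ℝ (lint α) f ∧
  (∀ i ≤ lint α, ∃ C : ℝ, ∀ x, ‖iteratedFDeriv ℝ i f x‖ ≤ C) ∧
  ∃ C : ℝ, ∀ x y, ‖iteratedFDeriv ℝ (lint α) f x - iteratedFDeriv ℝ (lint α) f y‖
      ≤ C * ‖x - y‖ ^ (α - (lint α : ℝ))

/-- Membership in the Hölder class `C^α(X)`: restriction to `X` of an `α`-Hölder
function on `ℝ^d`. -/
def HolderOn (d : ℕ) (α : ℝ) (f : (Fin d → ℝ) → ℝ) (X : Set (Fin d → ℝ)) : Prop :=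
  ∃ g, IsHolder d α g ∧ Set.EqOn f g X

/-- Multi-index factorial `k! = k₁!⋯k_d!`. -/
def mfact {d : ℕ} (k : Fin d → ℕ) : ℕ := ∏ j, (k j).factorial

/-- The moment `m_k = ∫ y^k p(y) dy` of the kernel `p`. -/
def mmom {d : ℕ} (p : (Fin d → ℝ) → ℝ) (k : Fin d → ℕ) : ℝ :=
  ∫ y, (∏ j, (y j) ^ (k j)) * p y

/-- The finite set of multi-indices of degree `j`. -/
def mIdx (d j : ℕ) : Finset (Fin d → ℕ) :=
  (Fintype.piFinset fun _ : Fin d => Finset.range (j + 1)).filter fun k => mdeg k = j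

/-- Auxiliary recursion (on an upper bound for the degree) computing the numbers `d_n`
defined recursively by `d_n = -m_n/n!` for `n. = 1` and, for `n. ≥ 2`,
`d_n = (-1)^{n.} m_n/n! - ∑_{n=l+k, l.≥1, k.≥1} ((-1)^{k.}/k!) m_k d_l`. -/
def dAux {d : ℕ} (p : (Fin d → ℝ) → ℝ) : ℕ → (Fin d → ℕ) → ℝ
  | 0, _ => 0
  | (N + 1), n =>
      if mdeg n = 1 then -(mmom p n) / (mfact n : ℝ)
      else (-1 : ℝ) ^ (mdeg n) * mmom p n / (mfact n : ℝ)
        - ∑ l ∈ (Fintype.piFinset fun j => Finset.range (n j + 1)).filter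
            (fun l => 1 ≤ mdeg l ∧ l ≠ n),
            ((-1 : ℝ) ^ (mdeg (n - l)) / (mfact (n - l) : ℝ)) * mmom p (n - l) * dAux p N l

/-- The numbers `d_n`. -/
def dcoef {d : ℕ} (p : (Fin d → ℝ) → ℝ) (n : Fin d → ℕ) : ℝ := dAux p (mdeg n) n

/-- The numbers `c_n`: `c_n = 0` if `n. = 1` and `c_n = d_n - (-1)^{n.} m_n/n!` if
`n. ≥ 2` (equivalently, `c_n = -∑_{n=l+k, l.≥1, k.≥1} ((-1)^{k.}/k!) m_k d_l`). -/
def ccoef {d : ℕ} (p : (Fin d → ℝ) → ℝ) (n : Fin d → ℕ) : ℝ :=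
  if mdeg n ≤ 1 then 0
  else dcoef p n - (-1 : ℝ) ^ (mdeg n) * mmom p n / (mfact n : ℝ)

/-- First-order partial derivative in direction `i`. -/
def pd {d : ℕ} (i : Fin d) (f : (Fin d → ℝ) → ℝ) : (Fin d → ℝ) → ℝ :=
  fun x => fderiv ℝ f x (Pi.single i 1)

/-- The partial derivative `D^j_k = ∂^{k.}/(∂x₁^{k₁}⋯∂x_d^{k_d})`. -/
def mpd {d : ℕ} (k : Fin d → ℕ) (f : (Fin d → ℝ) → ℝ) : (Fin d → ℝ) → ℝ :=
  (List.finRange d).foldr (fun i g => (pd i)^[k i] g) f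

/-- The transform `T^{(b)}_σ f = f - ∑_{i=1}^{b} ∑_{l.=i} d_l σ^i D^i_l f`. -/
def Tb {d : ℕ} (p : (Fin d → ℝ) → ℝ) (b : ℕ) (σ : ℝ)
    (f : (Fin d → ℝ) → ℝ) : (Fin d → ℝ) → ℝ :=
  fun x => f x - ∑ i ∈ Finset.Icc 1 b, ∑ l ∈ mIdx d i, dcoef p l * σ ^ i * mpd l f x

/-- The transform `T_{α,σ} f = f - ∑_{j=1}^{β} ∑_{k.=j} d_k σ^j D^j_k f`, `β = lint α`. -/
def Ttrans {d : ℕ} (p : (Fin d → ℝ) → ℝ) (α σ : ℝ)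
    (f : (Fin d → ℝ) → ℝ) : (Fin d → ℝ) → ℝ :=
  Tb p (lint α) σ f

/-- Convolution on `ℝ^d`: `(f * g)(x) = ∫ f(x-y) g(y) dy`. -/
def conv {d : ℕ} (f g : (Fin d → ℝ) → ℝ) (x : Fin d → ℝ) : ℝ :=
  ∫ y, f (x - y) * g y

/-- The rescaled kernel `p_σ(x) = σ^{-d} p(x/σ)`. -/
def psig {d : ℕ} (p : (Fin d → ℝ) → ℝ) (σ : ℝ) (x : Fin d → ℝ) : ℝ :=
  (1 / σ ^ d) * p fun j => x j / σ

/-- The multi-indices of degree at most `b`. -/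
def degLE (d b : ℕ) : Finset (Fin d → ℕ) :=
  (Fintype.piFinset fun _ : Fin d => Finset.range (b + 1)).filter fun k => mdeg k ≤ b

/-- The normalised monomial `h^k / k!`. -/
def dpow {d : ℕ} (k : Fin d → ℕ) (h : Fin d → ℝ) : ℝ :=
  ∏ j, (h j) ^ (k j) / ((k j).factorial : ℝ)

lemma le_mdeg {d : ℕ} (k : Fin d → ℕ) (j : Fin d) : k j ≤ mdeg k :=
  Finset.single_le_sum (f := k) (fun _ _ => Nat.zero_le _) (Finset.mem_univ j)

lemma mdeg_add {d : ℕ} (k l : Fin d → ℕ) : mdeg (k + l) = mdeg k + mdeg l := by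
  simp [mdeg, Finset.sum_add_distrib]

lemma mdeg_single {d : ℕ} (i : Fin d) : mdeg (Pi.single i 1 : Fin d → ℕ) = 1 := by
  simp [mdeg]

lemma mdeg_zero {d : ℕ} : mdeg (0 : Fin d → ℕ) = 0 := by simp [mdeg]

lemma mdeg_eq_zero {d : ℕ} {k : Fin d → ℕ} : mdeg k = 0 ↔ k = 0 := by
  simp [mdeg, funext_iff]

lemma mem_degLE {d b : ℕ} {k : Fin d → ℕ} : k ∈ degLE d b ↔ mdeg k ≤ b := by
  simp only [degLE, Finset.mem_filter, Fintype.mem_piFinset, Finset.mem_range,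
    and_iff_right_iff_imp]
  exact fun h j => Nat.lt_succ_of_le ((le_mdeg k j).trans h)

lemma mem_mIdx {d b : ℕ} {k : Fin d → ℕ} : k ∈ mIdx d b ↔ mdeg k = b := by
  simp only [mIdx, Finset.mem_filter, Fintype.mem_piFinset, Finset.mem_range,
    and_iff_right_iff_imp]
  exact fun h j => Nat.lt_succ_of_le ((le_mdeg k j).trans h.le)

lemma degLE_zero (d : ℕ) : degLE d 0 = {0} := by
  ext k
  simp [mem_degLE, mdeg_eq_zero]

lemma dpow_zero {d : ℕ} (h : Fin d → ℝ) : dpow 0 h = 1 := by simp [dpow]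

lemma dpow_eq {d : ℕ} (k : Fin d → ℕ) (h : Fin d → ℝ) :
    dpow k h = (∏ j, (h j) ^ (k j)) / (mfact k : ℝ) := by
  simp [dpow, mfact, Finset.prod_div_distrib]

lemma dpow_smul {d : ℕ} (k : Fin d → ℕ) (t : ℝ) (h : Fin d → ℝ) :
    dpow k (t • h) = t ^ mdeg k * dpow k h := by
  simp only [dpow, mdeg, ← Finset.prod_pow_eq_pow_sum, ← Finset.prod_mul_distrib]
  refine Finset.prod_congr rfl fun j _ => ?_
  simp [mul_pow, mul_div_assoc]

lemma dpow_add_single {d : ℕ} (k : Fin d → ℕ) (i : Fin d) (h : Fin d → ℝ) :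
    ((k + Pi.single i 1 : Fin d → ℕ) i : ℝ) * dpow (k + Pi.single i 1) h = h i * dpow k h := by
  have key : ∏ j ∈ Finset.univ.erase i, (h j) ^ ((k + Pi.single i 1 : Fin d → ℕ) j) /
      (((k + Pi.single i 1 : Fin d → ℕ) j).factorial : ℝ) =
      ∏ j ∈ Finset.univ.erase i, (h j) ^ (k j) / ((k j).factorial : ℝ) := by
    refine Finset.prod_congr rfl fun j hj => ?_
    simp [Pi.single_eq_of_ne (Finset.ne_of_mem_erase hj)]
  rw [dpow, dpow, ← Finset.mul_prod_erase _ _ (Finset.mem_univ i), key,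
    ← Finset.mul_prod_erase _ _ (Finset.mem_univ i)]
  have : ((k i).factorial : ℝ) ≠ 0 := by positivity
  simp only [Pi.add_apply, Pi.single_eq_same, Nat.factorial_succ]
  push_cast
  field_simp
  ring

lemma sum_degLE_succ_mul_mdeg {d : ℕ} (m : ℕ) (t : ℝ) (h : Fin d → ℝ) (c : (Fin d → ℕ) → ℝ) :
    ∑ k ∈ degLE d (m + 1), (mdeg k : ℝ) * t ^ (mdeg k - 1) * dpow k h * c k =
      ∑ i, h i * ∑ k ∈ degLE d m, t ^ mdeg k * dpow k h * c (k + Pi.single i 1) := by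
  have h1 : ∀ k : Fin d → ℕ, (mdeg k : ℝ) * t ^ (mdeg k - 1) * dpow k h * c k =
      ∑ i, t ^ (mdeg k - 1) * ((k i : ℝ) * dpow k h) * c k := by
    intro k
    rw [mdeg, Nat.cast_sum, Finset.sum_mul, Finset.sum_mul, Finset.sum_mul]
    exact Finset.sum_congr rfl fun i _ => by ring
  rw [Finset.sum_congr rfl fun k _ => h1 k, Finset.sum_comm]
  refine Finset.sum_congr rfl fun i _ => ?_
  rw [Finset.mul_sum]
  symm
  refine Finset.sum_bij_ne_zero (fun k _ _ => k + Pi.single i 1) ?_ ?_ ?_ ?_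
  · intro k hk _
    rw [mem_degLE] at hk ⊢
    rw [mdeg_add, mdeg_single]
    omega
  · intro a _ _ b _ _ hab
    exact add_right_cancel hab
  · intro k hk hne
    have hki : k i ≠ 0 := by
      rintro h0
      simp [h0] at hne
    have hkk : k - Pi.single i 1 + Pi.single i 1 = k := by
      ext j
      by_cases hj : j = i
      · subst hj
        simp
        omega
      · simp [Pi.single_eq_of_ne hj]
    have hdeg := congrArg mdeg hkk
    rw [mdeg_add, mdeg_single] at hdeg
    rw [mem_degLE] at hk
    refine ⟨k - Pi.single i 1, mem_degLE.2 (by omega), ?_, hkk⟩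
    rw [← hkk, mdeg_add, mdeg_single, dpow_add_single] at hne
    intro h0
    apply hne
    rw [← h0, Nat.add_sub_cancel]
    ring
  · intro k _ _
    rw [dpow_add_single, mdeg_add, mdeg_single, Nat.add_sub_cancel]
    ring

/-- Taylor's formula with Hölder remainder for a family `F` that behaves like the partial
derivatives of a function. -/
lemma abs_sub_taylor_le {d b : ℕ} {F : (Fin d → ℕ) → (Fin d → ℝ) → ℝ}
    (hF : ∀ k, mdeg k < b → ∀ x,
      HasFDerivAt (F k) (∑ i, F (k + Pi.single i 1) x •
        (ContinuousLinearMap.proj i : (Fin d → ℝ) →L[ℝ] ℝ)) x)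
    {C γ : ℝ} (hC : 0 ≤ C) (hγ : 0 < γ)
    (hH : ∀ k, mdeg k = b → ∀ x y, |F k x - F k y| ≤ C * ‖x - y‖ ^ γ)
    (m : ℕ) (l : Fin d → ℕ) (hl : mdeg l + m = b) (x h : Fin d → ℝ) :
    |F l (x + h) - ∑ k ∈ degLE d m, dpow k h * F (l + k) x| ≤
      C * (d : ℝ) ^ m * ‖h‖ ^ (m + γ) := by
  induction m generalizing l h with
  | zero =>
    simpa [degLE_zero, dpow_zero] using hH l hl (x + h) x
  | succ m ih =>
    set φ : ℝ → ℝ := fun t =>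
      F l (x + t • h) - ∑ k ∈ degLE d (m + 1), dpow k (t • h) * F (l + k) x with hφ
    set φ' : ℝ → ℝ := fun t => ∑ i, h i * (F (l + Pi.single i 1) (x + t • h) -
      ∑ k ∈ degLE d m, dpow k (t • h) * F (l + Pi.single i 1 + k) x) with hφ'
    have hder : ∀ t, HasDerivAt φ (φ' t) t := by
      intro t
      have e1 : HasDerivAt (fun t : ℝ => x + t • h) h t := by
        simpa using ((hasDerivAt_id t).smul_const h).const_add x
      have e2 := (hF l (by omega) (x + t • h)).comp_hasDerivAt t e1
      have e3 : HasDerivAt (fun t : ℝ => ∑ k ∈ degLE d (m + 1), dpow k (t • h) * F (l + k) x)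
          (∑ k ∈ degLE d (m + 1), (mdeg k : ℝ) * t ^ (mdeg k - 1) * dpow k h * F (l + k) x)
          t := by
        simp only [dpow_smul]
        refine HasDerivAt.fun_sum fun k _ => ?_
        exact ((hasDerivAt_pow (mdeg k) t).mul_const _).mul_const _
      rw [sum_degLE_succ_mul_mdeg m t h (fun k => F (l + k) x)] at e3
      have e4 := e2.sub e3
      refine e4.congr_deriv ?_
      simp only [hφ', mul_sub, Finset.sum_sub_distrib, sum_apply,
        smul_apply, ContinuousLinearMap.proj_apply, smul_eq_mul, dpow_smul]
      congr 1
      · exact Finset.sum_congr rfl fun i _ => mul_comm _ _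
      · refine Finset.sum_congr rfl fun i _ => ?_
        congr 1
        refine Finset.sum_congr rfl fun k _ => ?_
        rw [add_assoc, add_comm (Pi.single i 1) k]
    have hbound : ∀ t ∈ Set.Ico (0 : ℝ) 1, ‖φ' t‖ ≤
        C * (d : ℝ) ^ (m + 1) * ‖h‖ ^ ((m + 1 : ℕ) + γ) := by
      intro t ht
      have hth : ‖t • h‖ ≤ ‖h‖ := by
        rw [norm_smul, Real.norm_eq_abs, abs_of_nonneg ht.1]
        exact mul_le_of_le_one_left (norm_nonneg _) ht.2.le
      have hpow : ‖h‖ ^ ((m + 1 : ℕ) + γ) = ‖h‖ * ‖h‖ ^ (m + γ) := by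
        rw [← Real.rpow_one_add' (norm_nonneg _) (by positivity)]
        congr 1
        push_cast
        ring
      have hterm : ∀ i ∈ (Finset.univ : Finset (Fin d)),
          ‖h i * (F (l + Pi.single i 1) (x + t • h) -
            ∑ k ∈ degLE d m, dpow k (t • h) * F (l + Pi.single i 1 + k) x)‖ ≤
          ‖h‖ * (C * (d : ℝ) ^ m * ‖h‖ ^ (m + γ)) := by
        intro i _
        rw [norm_mul]
        refine mul_le_mul (norm_le_pi_norm h i) ?_ (norm_nonneg _) (norm_nonneg _)
        refine (ih (l + Pi.single i 1) (by rw [mdeg_add, mdeg_single]; omega) (t • h)).trans ?_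
        gcongr
      refine (norm_sum_le _ _).trans ((Finset.sum_le_sum hterm).trans_eq ?_)
      rw [Finset.sum_const, Finset.card_univ, Fintype.card_fin, nsmul_eq_mul, hpow]
      ring
    have hmv := norm_image_sub_le_of_norm_deriv_le_segment_01'
      (fun t _ => (hder t).hasDerivWithinAt) hbound
    have h0 : φ 0 = 0 := by
      simp only [hφ, dpow_smul, zero_smul, add_zero]
      rw [Finset.sum_eq_single (0 : Fin d → ℕ)]
      · simp [mdeg_zero, dpow_zero]
      · intro k _ hk
        simp [mt mdeg_eq_zero.1 hk]
      · intro hk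
        exact absurd (mem_degLE.2 (by simp [mdeg_zero])) hk
    rw [h0, sub_zero] at hmv
    simpa [hφ] using hmv

/-- The iterated partial derivative along a word of coordinate directions. -/
def wordDeriv {d : ℕ} (w : List (Fin d)) (f : (Fin d → ℝ) → ℝ) : (Fin d → ℝ) → ℝ :=
  w.foldr pd f

/-- The sorted word in which the letter `i` occurs `k i` times. -/
def sortedWord {d : ℕ} (k : Fin d → ℕ) : List (Fin d) :=
  (List.finRange d).flatMap fun i => List.replicate (k i) i

lemma mpd_eq_wordDeriv {d : ℕ} (k : Fin d → ℕ) (f : (Fin d → ℝ) → ℝ) :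
    mpd k f = wordDeriv (sortedWord k) f := by
  have hrep : ∀ (n : ℕ) (i : Fin d) (g : (Fin d → ℝ) → ℝ),
      (List.replicate n i).foldr pd g = (pd i)^[n] g := by
    intro n i g
    induction n with
    | zero => rfl
    | succ n ih => rw [List.replicate_succ, List.foldr_cons, ih, Function.iterate_succ_apply']
  simp only [mpd, wordDeriv, sortedWord]
  induction List.finRange d with
  | nil => rfl
  | cons a L ih => rw [List.foldr_cons, ih, List.flatMap_cons, List.foldr_append, hrep]

lemma count_sortedWord {d : ℕ} (k : Fin d → ℕ) (i : Fin d) : (sortedWord k).count i = k i := by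
  rw [sortedWord, List.count_flatMap]
  have : (List.count i ∘ fun j => List.replicate (k j) j) = fun j => if j = i then k j else 0 := by
    funext j
    simp [List.count_replicate]
  rw [this, ← List.ofFn_eq_map, List.sum_ofFn]
  simp

lemma length_sortedWord {d : ℕ} (k : Fin d → ℕ) : (sortedWord k).length = mdeg k := by
  rw [sortedWord, List.length_flatMap, ← List.ofFn_eq_map, List.sum_ofFn]
  simp [mdeg]

lemma sortedWord_add_single {d : ℕ} (k : Fin d → ℕ) (i : Fin d) :
    (sortedWord (k + Pi.single i 1)).Perm (i :: sortedWord k) := by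
  rw [List.perm_iff_count]
  intro j
  rw [count_sortedWord, List.count_cons, count_sortedWord]
  by_cases h : i = j
  · subst h
    simp
  · simp [h]

lemma wordDeriv_eq_iteratedFDeriv {d b : ℕ} {f : (Fin d → ℝ) → ℝ} (hf : ContDiff ℝ b f)
    (w : List (Fin d)) (hw : w.length ≤ b) :
    wordDeriv w f = fun x => iteratedFDeriv ℝ w.length f x fun j => Pi.single (w.get j) 1 := by
  induction w with
  | nil =>
    funext x
    simp [wordDeriv]
  | cons a w ih =>
    rw [List.length_cons] at hw
    funext x
    have hd : DifferentiableAt ℝ (iteratedFDeriv ℝ w.length f) x :=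
      (hf.differentiable_iteratedFDeriv (by exact_mod_cast hw)) x
    change fderiv ℝ (wordDeriv w f) x (Pi.single a 1) = _
    rw [ih (by omega)]
    rw [(hd.hasFDerivAt.continuousMultilinear_apply_const _).fderiv]
    rfl

lemma contDiff_wordDeriv {d b : ℕ} {f : (Fin d → ℝ) → ℝ} (hf : ContDiff ℝ b f)
    (w : List (Fin d)) (m : ℕ) (hw : w.length + m ≤ b) : ContDiff ℝ m (wordDeriv w f) := by
  induction w generalizing m with
  | nil =>
    simp only [List.length_nil, zero_add] at hw
    exact hf.of_le (by exact_mod_cast hw)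
  | cons a w ih =>
    rw [List.length_cons] at hw
    have h1 := ih (m + 1) (by omega)
    have h2 : ContDiff ℝ m (fderiv ℝ (wordDeriv w f)) :=
      h1.fderiv_right (by push_cast; exact le_rfl)
    exact h2.clm_apply contDiff_const

lemma pd_comm {d : ℕ} {g : (Fin d → ℝ) → ℝ} (hg : ContDiff ℝ 2 g) (i j : Fin d) :
    pd i (pd j g) = pd j (pd i g) := by
  funext x
  have hd : DifferentiableAt ℝ (fderiv ℝ g) x :=
    ((hg.fderiv_right (m := 1) (by norm_num)).differentiable (by norm_num)) x
  have hs : IsSymmSndFDerivAt ℝ g x := hg.contDiffAt.isSymmSndFDerivAt (by simp)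
  have key : ∀ a b : Fin d, pd a (pd b g) x =
      fderiv ℝ (fderiv ℝ g) x (Pi.single a 1) (Pi.single b 1) := by
    intro a b
    change fderiv ℝ (fun y => fderiv ℝ g y (Pi.single b 1)) x (Pi.single a 1) = _
    rw [fderiv_clm_apply hd (differentiableAt_const _)]
    simp
  rw [key, key, hs.eq]

lemma wordDeriv_perm {d b : ℕ} {f : (Fin d → ℝ) → ℝ} (hf : ContDiff ℝ b f)
    {w v : List (Fin d)} (hwv : w.Perm v) (hw : w.length ≤ b) : wordDeriv w f = wordDeriv v f := by
  induction hwv with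
  | nil => rfl
  | cons a _ ih =>
    rw [List.length_cons] at hw
    exact congrArg (pd a) (ih (by omega))
  | swap a c w =>
    simp only [List.length_cons] at hw
    exact pd_comm (contDiff_wordDeriv hf w 2 (by omega)) c a
  | trans h1 _ ih1 ih2 =>
    rw [ih1 hw, ih2 (h1.length_eq ▸ hw)]

lemma mpd_add_single {d b : ℕ} {f : (Fin d → ℝ) → ℝ} (hf : ContDiff ℝ b f)
    (k : Fin d → ℕ) (hk : mdeg k < b) (i : Fin d) :
    mpd (k + Pi.single i 1) f = pd i (mpd k f) := by
  rw [mpd_eq_wordDeriv, mpd_eq_wordDeriv, wordDeriv_perm hf (sortedWord_add_single k i)]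
  · rfl
  · rw [length_sortedWord, mdeg_add, mdeg_single]
    omega

lemma contDiff_mpd {d b : ℕ} {f : (Fin d → ℝ) → ℝ} (hf : ContDiff ℝ b f)
    (k : Fin d → ℕ) (m : ℕ) (hk : mdeg k + m ≤ b) : ContDiff ℝ m (mpd k f) := by
  rw [mpd_eq_wordDeriv]
  exact contDiff_wordDeriv hf _ m (by rwa [length_sortedWord])

lemma hasFDerivAt_mpd {d b : ℕ} {f : (Fin d → ℝ) → ℝ} (hf : ContDiff ℝ b f)
    (k : Fin d → ℕ) (hk : mdeg k < b) (x : Fin d → ℝ) :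
    HasFDerivAt (mpd k f) (∑ i, mpd (k + Pi.single i 1) f x •
        (ContinuousLinearMap.proj i : (Fin d → ℝ) →L[ℝ] ℝ)) x := by
  have h1 : HasFDerivAt (mpd k f) (fderiv ℝ (mpd k f) x) x :=
    (((contDiff_mpd hf k 1 hk).differentiable (by norm_num)) x).hasFDerivAt
  refine h1.congr_fderiv (ContinuousLinearMap.ext fun v => ?_)
  simp only [mpd_add_single hf k hk, pd, sum_apply,
    smul_apply, ContinuousLinearMap.proj_apply, smul_eq_mul]
  have hv : v = ∑ i, v i • (Pi.single i 1 : Fin d → ℝ) := pi_eq_sum_univ' v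
  have hmap := congrArg (fderiv ℝ (mpd k f) x) hv
  rw [map_sum] at hmap
  rw [hmap]
  exact Finset.sum_congr rfl fun i _ => by rw [map_smul, smul_eq_mul, mul_comm]

lemma abs_apply_single_le {d n : ℕ} (T : ContinuousMultilinearMap ℝ (fun _ : Fin n => Fin d → ℝ) ℝ)
    (w : Fin n → Fin d) : |T fun j => Pi.single (w j) 1| ≤ ‖T‖ := by
  have := T.le_opNorm fun j => (Pi.single (w j) 1 : Fin d → ℝ)
  simpa [Pi.norm_single] using this

lemma mpd_eq_iteratedFDeriv {d b : ℕ} {f : (Fin d → ℝ) → ℝ} (hf : ContDiff ℝ b f)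
    (k : Fin d → ℕ) (hk : mdeg k ≤ b) :
    ∃ w : Fin (mdeg k) → Fin d,
      mpd k f = fun x => iteratedFDeriv ℝ (mdeg k) f x fun j => Pi.single (w j) 1 := by
  rw [mpd_eq_wordDeriv, ← length_sortedWord k]
  exact ⟨(sortedWord k).get, wordDeriv_eq_iteratedFDeriv hf _ (by rwa [length_sortedWord])⟩

lemma exists_abs_mpd_le {d b : ℕ} {f : (Fin d → ℝ) → ℝ} (hf : ContDiff ℝ b f)
    (hfb : ∀ i ≤ b, ∃ C : ℝ, ∀ x, ‖iteratedFDeriv ℝ i f x‖ ≤ C)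
    (k : Fin d → ℕ) (hk : mdeg k ≤ b) : ∃ C : ℝ, ∀ x, |mpd k f x| ≤ C := by
  obtain ⟨w, hw⟩ := mpd_eq_iteratedFDeriv hf k hk
  obtain ⟨C, hC⟩ := hfb _ hk
  refine ⟨C, fun x => ?_⟩
  rw [hw]
  exact (abs_apply_single_le _ w).trans (hC x)

lemma abs_mpd_sub_le {d b : ℕ} {f : (Fin d → ℝ) → ℝ} (hf : ContDiff ℝ b f) {C γ : ℝ}
    (hfH : ∀ x y, ‖iteratedFDeriv ℝ b f x - iteratedFDeriv ℝ b f y‖ ≤ C * ‖x - y‖ ^ γ)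
    (k : Fin d → ℕ) (hk : mdeg k = b) (x y : Fin d → ℝ) :
    |mpd k f x - mpd k f y| ≤ C * ‖x - y‖ ^ γ := by
  subst hk
  obtain ⟨w, hw⟩ := mpd_eq_iteratedFDeriv hf k le_rfl
  rw [hw]
  exact (abs_apply_single_le (iteratedFDeriv ℝ (mdeg k) f x - iteratedFDeriv ℝ (mdeg k) f y)
    w).trans (hfH x y)

lemma conv_psig {d : ℕ} (p g : (Fin d → ℝ) → ℝ) {σ : ℝ} (hσ : 0 < σ) (x : Fin d → ℝ) :
    conv (psig p σ) g x = ∫ u, p u * g (x - σ • u) := by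
  have h1 : conv (psig p σ) g x = ∫ y, psig p σ y * g (x - y) := by
    rw [conv, ← integral_sub_left_eq_self _ _ x]
    simp
  have h2 := Measure.integral_comp_smul (volume : Measure (Fin d → ℝ))
    (fun y => psig p σ y * g (x - y)) σ
  have h3 : ∀ u : Fin d → ℝ, psig p σ (σ • u) * g (x - σ • u) =
      (σ ^ d)⁻¹ * (p u * g (x - σ • u)) := by
    intro u
    have : (fun j => (σ • u) j / σ) = u := by
      funext j
      simp [hσ.ne']
    rw [psig, this]
    ring
  simp only [h3, Module.finrank_fin_fun, integral_const_mul, smul_eq_mul] at h2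
  have hpos : 0 < (σ ^ d)⁻¹ := by positivity
  rw [abs_of_pos hpos] at h2
  rw [h1]
  exact (mul_left_cancel₀ hpos.ne' h2).symm

/-- The coefficients of the transform `T_σ = ∑ e_l σ^{l.} D_l`. -/
def ecoef {d : ℕ} (p : (Fin d → ℝ) → ℝ) (l : Fin d → ℕ) : ℝ :=
  if l = 0 then 1 else -dcoef p l

/-- The coefficients of the expansion of the convolution with `p_σ`. -/
def acoef {d : ℕ} (p : (Fin d → ℝ) → ℝ) (k : Fin d → ℕ) : ℝ :=
  (-1 : ℝ) ^ mdeg k * mmom p k / (mfact k : ℝ)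

lemma mdeg_lt_of_le_of_ne {d : ℕ} {l n : Fin d → ℕ} (hle : l ≤ n) (hne : l ≠ n) :
    mdeg l < mdeg n := by
  obtain ⟨j, hj⟩ := Function.ne_iff.1 hne
  exact Finset.sum_lt_sum (fun i _ => hle i) ⟨j, Finset.mem_univ j, lt_of_le_of_ne (hle j) hj⟩

lemma dAux_eq_dcoef {d : ℕ} (p : (Fin d → ℝ) → ℝ) (N : ℕ) (n : Fin d → ℕ)
    (h1 : 1 ≤ mdeg n) (hN : mdeg n ≤ N) : dAux p N n = dcoef p n := by
  have key : ∀ (M N : ℕ) (n : Fin d → ℕ), 1 ≤ mdeg n → mdeg n ≤ N → mdeg n ≤ M →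
      dAux p N n = dAux p M n := by
    intro M
    induction M with
    | zero =>
      intro N n h1 _ h2
      omega
    | succ M ih =>
      intro N n h1 hN hM
      obtain ⟨N, rfl⟩ : ∃ N', N = N' + 1 := ⟨N - 1, by omega⟩
      simp only [dAux]
      congr 2
      refine Finset.sum_congr rfl fun l hl => ?_
      simp only [Finset.mem_filter, Fintype.mem_piFinset, Finset.mem_range] at hl
      have := mdeg_lt_of_le_of_ne (fun j => Nat.le_of_lt_succ (hl.1 j)) hl.2.2
      rw [ih N l hl.2.1 (by omega) (by omega)]
  exact key _ _ _ h1 hN le_rfl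

lemma dcoef_eq {d : ℕ} (p : (Fin d → ℝ) → ℝ) (n : Fin d → ℕ) (hn : 1 ≤ mdeg n) :
    dcoef p n = acoef p n - ∑ l ∈ (Finset.Iic n).filter fun l => l ≠ 0 ∧ l ≠ n,
      acoef p (n - l) * dcoef p l := by
  have hset : (Fintype.piFinset fun j => Finset.range (n j + 1)).filter
      (fun l => 1 ≤ mdeg l ∧ l ≠ n) = (Finset.Iic n).filter fun l => l ≠ 0 ∧ l ≠ n := by
    ext l
    simp only [Finset.mem_filter, Fintype.mem_piFinset, Finset.mem_range, Finset.mem_Iic,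
      Pi.le_def, Nat.lt_succ_iff, Nat.one_le_iff_ne_zero, ne_eq, mdeg_eq_zero]
  obtain ⟨N, hN⟩ : ∃ N, mdeg n = N + 1 := ⟨mdeg n - 1, by omega⟩
  rw [dcoef, hN, dAux, hset]
  have hsum : ∑ l ∈ (Finset.Iic n).filter (fun l => l ≠ 0 ∧ l ≠ n),
      ((-1 : ℝ) ^ (mdeg (n - l)) / (mfact (n - l) : ℝ)) * mmom p (n - l) * dAux p N l =
      ∑ l ∈ (Finset.Iic n).filter (fun l => l ≠ 0 ∧ l ≠ n), acoef p (n - l) * dcoef p l := by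
    refine Finset.sum_congr rfl fun l hl => ?_
    simp only [Finset.mem_filter, Finset.mem_Iic] at hl
    have hlt := mdeg_lt_of_le_of_ne hl.1 hl.2.2
    have := mt mdeg_eq_zero.1 hl.2.1
    rw [dAux_eq_dcoef p N l (by omega) (by omega), acoef]
    ring
  split_ifs with h1
  · rw [Finset.sum_eq_zero]
    · simp [acoef, h1]
    · intro l hl
      simp only [Finset.mem_filter, Finset.mem_Iic] at hl
      have hlt := mdeg_lt_of_le_of_ne hl.1 hl.2.2
      have := mt mdeg_eq_zero.1 hl.2.1
      omega
  · rw [hsum, acoef]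

lemma acoef_zero {d : ℕ} {p : (Fin d → ℝ) → ℝ} (hp1 : (∫ x, p x) = 1) :
    acoef p (0 : Fin d → ℕ) = 1 := by
  simp [acoef, mdeg_zero, mmom, mfact, hp1]

lemma sum_ecoef_mul_acoef {d : ℕ} {p : (Fin d → ℝ) → ℝ} (hp1 : (∫ x, p x) = 1)
    (n : Fin d → ℕ) :
    ∑ l ∈ Finset.Iic n, ecoef p l * acoef p (n - l) = if n = 0 then 1 else 0 := by
  split_ifs with h
  · subst h
    have : Finset.Iic (0 : Fin d → ℕ) = {0} := by
      ext l
      simp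
    rw [this]
    simp [ecoef, acoef_zero hp1]
  · have h0 : (0 : Fin d → ℕ) ∈ Finset.Iic n := by simp
    have hn : n ∈ (Finset.Iic n).erase 0 := by simp [h]
    rw [← Finset.add_sum_erase _ _ h0, ← Finset.add_sum_erase _ _ hn]
    have hset : ((Finset.Iic n).erase 0).erase n =
        (Finset.Iic n).filter fun l => l ≠ 0 ∧ l ≠ n := by
      ext l
      simp only [Finset.mem_erase, Finset.mem_filter]
      tauto
    have hsum : ∑ l ∈ (Finset.Iic n).filter (fun l => l ≠ 0 ∧ l ≠ n),
        ecoef p l * acoef p (n - l) =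
        -∑ l ∈ (Finset.Iic n).filter (fun l => l ≠ 0 ∧ l ≠ n), acoef p (n - l) * dcoef p l := by
      rw [← Finset.sum_neg_distrib]
      refine Finset.sum_congr rfl fun l hl => ?_
      simp only [Finset.mem_filter] at hl
      rw [ecoef, if_neg hl.2.1]
      ring
    rw [hset, hsum]
    simp only [ecoef, if_true, if_neg h, tsub_zero, tsub_self, acoef_zero hp1]
    rw [dcoef_eq p n (Nat.one_le_iff_ne_zero.2 (mt mdeg_eq_zero.1 h))]
    ring

lemma sum_degLE_sum_degLE {d b : ℕ} (G : (Fin d → ℕ) → (Fin d → ℕ) → ℝ) :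
    ∑ l ∈ degLE d b, ∑ k ∈ degLE d (b - mdeg l), G l k =
      ∑ n ∈ degLE d b, ∑ l ∈ Finset.Iic n, G l (n - l) := by
  rw [Finset.sum_sigma', Finset.sum_sigma']
  refine Finset.sum_bij' (fun a _ => ⟨a.1 + a.2, a.1⟩) (fun a _ => ⟨a.2, a.1 - a.2⟩) ?_ ?_ ?_ ?_ ?_
  · rintro ⟨l, k⟩ h
    simp only [Finset.mem_sigma, mem_degLE, Finset.mem_Iic, mdeg_add] at h ⊢
    exact ⟨by omega, le_self_add⟩
  · rintro ⟨n, l⟩ h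
    simp only [Finset.mem_sigma, mem_degLE, Finset.mem_Iic] at h ⊢
    have := mdeg_add l (n - l)
    rw [add_tsub_cancel_of_le h.2] at this
    omega
  · rintro ⟨l, k⟩ _
    simp
  · rintro ⟨n, l⟩ h
    simp only [Finset.mem_sigma, Finset.mem_Iic] at h
    simp [add_tsub_cancel_of_le h.2]
  · rintro ⟨l, k⟩ _
    simp

lemma mpd_zero {d : ℕ} (f : (Fin d → ℝ) → ℝ) : mpd 0 f = f := by
  have : sortedWord (0 : Fin d → ℕ) = [] :=
    List.length_eq_zero_iff.1 (by rw [length_sortedWord, mdeg_zero])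
  rw [mpd_eq_wordDeriv, this]
  rfl

lemma Tb_eq_sum {d : ℕ} (p : (Fin d → ℝ) → ℝ) (b : ℕ) (σ : ℝ) (f : (Fin d → ℝ) → ℝ)
    (x : Fin d → ℝ) :
    Tb p b σ f x = ∑ l ∈ degLE d b, ecoef p l * σ ^ mdeg l * mpd l f x := by
  have h0 : (0 : Fin d → ℕ) ∈ degLE d b := mem_degLE.2 (by simp [mdeg_zero])
  have hmaps : ∀ l ∈ (degLE d b).erase 0, mdeg l ∈ Finset.Icc 1 b := by
    intro l hl
    rw [Finset.mem_erase, mem_degLE] at hl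
    exact Finset.mem_Icc.2 ⟨Nat.one_le_iff_ne_zero.2 (mt mdeg_eq_zero.1 hl.1), hl.2⟩
  rw [← Finset.add_sum_erase _ _ h0, ← Finset.sum_fiberwise_of_maps_to hmaps, Tb, sub_eq_add_neg,
    ← Finset.sum_neg_distrib]
  congr 1
  · simp [ecoef, mdeg_zero, mpd_zero]
  · refine Finset.sum_congr rfl fun i hi => ?_
    rw [← Finset.sum_neg_distrib]
    have hset : ((degLE d b).erase 0).filter (fun l => mdeg l = i) = mIdx d i := by
      ext l
      simp only [Finset.mem_filter, Finset.mem_erase, mem_degLE, mem_mIdx, Finset.mem_Icc] at hi ⊢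
      refine ⟨fun h => h.2, fun h => ⟨⟨fun hl => ?_, by omega⟩, h⟩⟩
      rw [hl, mdeg_zero] at h
      omega
    rw [hset]
    refine Finset.sum_congr rfl fun l hl => ?_
    rw [mem_mIdx] at hl
    have hl0 : l ≠ 0 := by
      rintro rfl
      rw [mdeg_zero] at hl
      simp only [Finset.mem_Icc] at hi
      omega
    rw [ecoef, if_neg hl0, hl]
    ring

lemma integrable_dpow_mul {d : ℕ} {p : (Fin d → ℝ) → ℝ} (hpint : Integrable p)
    (hpmom : ∀ k : ℕ, Integrable fun x => ‖x‖ ^ k * |p x|) (k : Fin d → ℕ) :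
    Integrable fun u => (∏ j, (u j) ^ (k j)) * p u := by
  refine (hpmom (mdeg k)).mono' ?_ ?_
  · exact (by fun_prop : Continuous fun u : Fin d → ℝ => ∏ j, (u j) ^ (k j)).aestronglyMeasurable.mul
      hpint.aestronglyMeasurable
  · refine Filter.Eventually.of_forall fun u => ?_
    rw [norm_mul, norm_prod, mdeg, ← Finset.prod_pow_eq_pow_sum]
    refine mul_le_mul_of_nonneg_right ?_ (norm_nonneg _)
    refine Finset.prod_le_prod (fun _ _ => norm_nonneg _) fun j _ => ?_
    rw [norm_pow]
    exact pow_le_pow_left₀ (norm_nonneg _) (norm_le_pi_norm u j) _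

lemma mul_dpow_neg_smul {d : ℕ} (p : (Fin d → ℝ) → ℝ) (k : Fin d → ℕ) (σ : ℝ) (u : Fin d → ℝ) :
    p u * dpow k (-(σ • u)) =
      (-1 : ℝ) ^ mdeg k * σ ^ mdeg k / (mfact k : ℝ) * ((∏ j, (u j) ^ (k j)) * p u) := by
  rw [← neg_smul, dpow_smul, dpow_eq, neg_pow]
  ring

lemma integral_mul_dpow {d : ℕ} (p : (Fin d → ℝ) → ℝ) (k : Fin d → ℕ) (σ : ℝ) :
    ∫ u, p u * dpow k (-(σ • u)) = σ ^ mdeg k * acoef p k := by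
  simp only [mul_dpow_neg_smul, integral_const_mul]
  rw [acoef, mmom]
  ring

lemma rpow_le_one_add_pow {r s : ℝ} {N : ℕ} (hr : 0 ≤ r) (hs : 0 ≤ s) (hsN : s ≤ N) :
    r ^ s ≤ 1 + r ^ N := by
  rcases le_total r 1 with h | h
  · exact (Real.rpow_le_one hr h hs).trans (le_add_of_nonneg_right (by positivity))
  · rw [← Real.rpow_natCast]
    exact (Real.rpow_le_rpow_of_exponent_le h hsN).trans (le_add_of_nonneg_left zero_le_one)

/-- **Lemma 3.4.** For an integrable kernel `p` with `∫ p = 1` and all absolute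
moments finite, and `f ∈ C^α(ℝ^d)`, the convolution of `p_σ` with the transform
`T_{α,σ} f` approximates `f` uniformly to the order `σ^α`:
`‖p_σ * (T_{α,σ} f) - f‖_∞ ≤ K₆ σ^α` for all `σ > 0`, with `K₆` independent of `σ`. -/
theorem convolution_transform_approximation
    {d : ℕ} (hd : 0 < d) {p : (Fin d → ℝ) → ℝ}
    (hpint : Integrable p) (hp1 : (∫ x, p x) = 1)
    (hpmom : ∀ k : ℕ, Integrable fun x => ‖x‖ ^ k * |p x|)
    {α : ℝ} (hα : 0 < α) {f : (Fin d → ℝ) → ℝ} (hf : IsHolder d α f) :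
    ∃ K₆ : ℝ, 0 < K₆ ∧ ∀ σ : ℝ, 0 < σ → ∀ x : Fin d → ℝ,
      |conv (psig p σ) (Ttrans p α σ f) x - f x| ≤ K₆ * σ ^ α := by
  have hceil : 0 < ⌈α⌉₊ := Nat.ceil_pos.2 hα
  have hb1 : α ≤ (lint α : ℝ) + 1 := by
    have h := Nat.le_ceil α
    have h2 : ⌈α⌉₊ = lint α + 1 := by
      rw [lint]
      omega
    rw [h2] at h
    exact_mod_cast h
  have hb2 : (lint α : ℝ) < α := Nat.lt_ceil.1 (by rw [lint]; omega)
  simp only [Ttrans]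
  obtain ⟨hfc, hfb, C₀, hfH⟩ := hf
  set b := lint α
  have hT := abs_sub_taylor_le (fun k hk x => hasFDerivAt_mpd hfc k hk x)
    (le_max_right C₀ 0) (sub_pos.2 hb2) (abs_mpd_sub_le hfc fun x y => (hfH x y).trans
      (mul_le_mul_of_nonneg_right (le_max_left C₀ 0) (by positivity)))
  set C := max C₀ 0
  have hC : 0 ≤ C := le_max_right _ _
  have hw : Integrable fun u : Fin d → ℝ => |p u| * (1 + ‖u‖ ^ (b + 1)) := by
    refine (hpint.abs.add (hpmom (b + 1))).congr (Filter.Eventually.of_forall fun u => ?_)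
    simp only [Pi.add_apply]
    ring
  set M := ∫ u : Fin d → ℝ, |p u| * (1 + ‖u‖ ^ (b + 1))
  have hM : 0 ≤ M := integral_nonneg fun u => by positivity
  set A := ∑ l ∈ degLE d b, |ecoef p l| * (C * (d : ℝ) ^ (b - mdeg l))
  have hA : 0 ≤ A := Finset.sum_nonneg fun l _ => by positivity
  refine ⟨A * M + 1, by positivity, fun σ hσ x => ?_⟩
  rw [conv_psig p _ hσ]
  set P : (Fin d → ℝ) → ℝ := fun u => ∑ l ∈ degLE d b, ecoef p l * σ ^ mdeg l *
    ∑ k ∈ degLE d (b - mdeg l), dpow k (-(σ • u)) * mpd (l + k) f x with hP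
  have hPmul : ∀ u, p u * P u = ∑ l ∈ degLE d b, ∑ k ∈ degLE d (b - mdeg l),
      (ecoef p l * σ ^ mdeg l * mpd (l + k) f x) * (p u * dpow k (-(σ • u))) := by
    intro u
    simp only [hP, Finset.mul_sum]
    exact Finset.sum_congr rfl fun l _ => Finset.sum_congr rfl fun k _ => by ring
  have hmono : ∀ k : Fin d → ℕ, Integrable fun u => p u * dpow k (-(σ • u)) := by
    intro k
    simp only [mul_dpow_neg_smul]
    exact (integrable_dpow_mul hpint hpmom k).const_mul _
  have hPint : Integrable fun u => p u * P u := by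
    simp only [hPmul]
    exact integrable_finsetSum _ fun l _ => integrable_finsetSum _ fun k _ =>
      (hmono k).const_mul _
  have hPval : ∫ u, p u * P u = f x := by
    simp only [hPmul]
    rw [integral_finsetSum _ fun l _ => integrable_finsetSum _ fun k _ => (hmono k).const_mul _]
    have h1 : ∀ l ∈ degLE d b, ∫ u, ∑ k ∈ degLE d (b - mdeg l),
        (ecoef p l * σ ^ mdeg l * mpd (l + k) f x) * (p u * dpow k (-(σ • u))) =
        ∑ k ∈ degLE d (b - mdeg l),
          σ ^ mdeg (l + k) * mpd (l + k) f x * (ecoef p l * acoef p k) := by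
      intro l _
      rw [integral_finsetSum _ fun k _ => (hmono k).const_mul _]
      refine Finset.sum_congr rfl fun k _ => ?_
      rw [integral_const_mul, integral_mul_dpow, mdeg_add, pow_add]
      ring
    rw [Finset.sum_congr rfl h1, sum_degLE_sum_degLE fun l k =>
      σ ^ mdeg (l + k) * mpd (l + k) f x * (ecoef p l * acoef p k)]
    have h2 : ∀ n ∈ degLE d b, ∑ l ∈ Finset.Iic n, σ ^ mdeg (l + (n - l)) *
        mpd (l + (n - l)) f x * (ecoef p l * acoef p (n - l)) =
        if n = 0 then f x else 0 := by
      intro n _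
      have h3 : ∀ l ∈ Finset.Iic n, σ ^ mdeg (l + (n - l)) *
          mpd (l + (n - l)) f x * (ecoef p l * acoef p (n - l)) =
          σ ^ mdeg n * mpd n f x * (ecoef p l * acoef p (n - l)) := by
        intro l hl
        rw [add_tsub_cancel_of_le (Finset.mem_Iic.1 hl)]
      rw [Finset.sum_congr rfl h3, ← Finset.mul_sum, sum_ecoef_mul_acoef hp1]
      split_ifs with h
      · simp [h, mdeg_zero, mpd_zero]
      · simp
    rw [Finset.sum_congr rfl h2, Finset.sum_ite_eq' (degLE d b) 0,
      if_pos (mem_degLE.2 (by simp [mdeg_zero]))]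
  have hTint : Integrable fun u => p u * Tb p b σ f (x - σ • u) := by
    simp only [Tb_eq_sum, Finset.mul_sum]
    refine integrable_finsetSum _ fun l hl => ?_
    rw [mem_degLE] at hl
    obtain ⟨B, hB⟩ := exists_abs_mpd_le hfc hfb l hl
    have hcont : Continuous (mpd l f) := (contDiff_mpd hfc l 0 (by simpa using hl)).continuous
    refine hpint.mul_bdd (c := |ecoef p l * σ ^ mdeg l| * B)
      (by fun_prop : Continuous fun u : Fin d → ℝ =>
        ecoef p l * σ ^ mdeg l * mpd l f (x - σ • u)).aestronglyMeasurable ?_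
    refine Filter.Eventually.of_forall fun u => ?_
    rw [Real.norm_eq_abs, abs_mul]
    exact mul_le_mul_of_nonneg_left (hB _) (abs_nonneg _)
  have hpt : ∀ u, ‖p u * Tb p b σ f (x - σ • u) - p u * P u‖ ≤
      A * σ ^ α * (|p u| * (1 + ‖u‖ ^ (b + 1))) := by
    intro u
    rw [← mul_sub, norm_mul, Tb_eq_sum, ← Finset.sum_sub_distrib]
    have hl : ∀ l ∈ degLE d b, ‖ecoef p l * σ ^ mdeg l * mpd l f (x - σ • u) -
        ecoef p l * σ ^ mdeg l *
          ∑ k ∈ degLE d (b - mdeg l), dpow k (-(σ • u)) * mpd (l + k) f x‖ ≤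
        |ecoef p l| * (C * (d : ℝ) ^ (b - mdeg l)) * (σ ^ α * (1 + ‖u‖ ^ (b + 1))) := by
      intro l hl
      rw [mem_degLE] at hl
      have hcast : ((b - mdeg l : ℕ) : ℝ) = b - mdeg l := Nat.cast_sub hl
      have hexp : 0 ≤ ((b - mdeg l : ℕ) : ℝ) + (α - b) :=
        add_nonneg (Nat.cast_nonneg _) (sub_nonneg.2 hb2.le)
      have h1 := hT (b - mdeg l) l (by omega) x (-(σ • u))
      rw [norm_neg, norm_smul, Real.norm_eq_abs, abs_of_pos hσ,
        Real.mul_rpow hσ.le (norm_nonneg _), ← sub_eq_add_neg] at h1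
      have h2 := rpow_le_one_add_pow (N := b + 1) (norm_nonneg u) hexp (by
        rw [hcast]
        push_cast
        have : (0 : ℝ) ≤ mdeg l := Nat.cast_nonneg _
        linarith)
      have h3 : σ ^ mdeg l * σ ^ (((b - mdeg l : ℕ) : ℝ) + (α - b)) = σ ^ α := by
        rw [← Real.rpow_natCast, ← Real.rpow_add hσ, hcast]
        congr 1
        ring
      rw [← mul_sub, norm_mul, norm_mul, norm_pow, Real.norm_eq_abs, Real.norm_eq_abs,
        Real.norm_eq_abs, abs_of_pos hσ, ← h3]
      calc _ ≤ |ecoef p l| * σ ^ mdeg l * (C * (d : ℝ) ^ (b - mdeg l) *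
            (σ ^ (((b - mdeg l : ℕ) : ℝ) + (α - b)) *
              ‖u‖ ^ (((b - mdeg l : ℕ) : ℝ) + (α - b)))) := by gcongr
        _ ≤ |ecoef p l| * σ ^ mdeg l * (C * (d : ℝ) ^ (b - mdeg l) *
            (σ ^ (((b - mdeg l : ℕ) : ℝ) + (α - b)) * (1 + ‖u‖ ^ (b + 1)))) := by gcongr
        _ = _ := by ring
    calc _ ≤ |p u| * ∑ l ∈ degLE d b, |ecoef p l| * (C * (d : ℝ) ^ (b - mdeg l)) *
          (σ ^ α * (1 + ‖u‖ ^ (b + 1))) := by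
          rw [Real.norm_eq_abs (p u)]
          exact mul_le_mul_of_nonneg_left ((norm_sum_le _ _).trans (Finset.sum_le_sum hl))
            (abs_nonneg _)
      _ = _ := by
          rw [← Finset.sum_mul]
          ring
  have hfin := norm_integral_le_of_norm_le (hw.const_mul (A * σ ^ α))
    (Filter.Eventually.of_forall hpt)
  rw [integral_sub hTint hPint, hPval, integral_const_mul, Real.norm_eq_abs] at hfin
  refine hfin.trans ?_
  have : 0 ≤ σ ^ α := by positivity
  change A * σ ^ α * M ≤ _
  nlinarith
end
end

section
/- Let d ∈ ℕ, γ ∈ (d/2,∞], p ∈ 𝒫_γ, α > 0 with β the largest integer strictly smaller than α, and fix 𝒳 = [a,b]^d with 0 < a < b < 1. Then there exist constants K₇, K₈, K₉ > 0, not depending on σ or m, such that for every σ > 0, every m ∈ ℕ and every w₀ ∈ C^α(𝒳) there exist real weights (w_k)_{k∈{1,…,m}^d} with m^d ∑_{k∈{1,…,m}^d} w_k² ≤ K₇² (1 ∨ σ)², such that the function h(x) = ∑_{k∈{1,…,m}^d} w_k σ^{−d} p((x − k/m)/σ) satisfies sup_{x∈𝒳} |h(x) − w₀(x)| ≤ K₈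 (1 ∨ σ^{β+1}) σ^{−(1+d)} m^{−(α−β)} + K₉ σ^α. (The constants K₇, K₈, K₉ may depend on w₀, p, α, d.) -/
open MeasureTheory ProbabilityTheory Filter Set
open scoped ENNReal NNReal Topology Real

noncomputable section

/-- Properties shared by all kernel classes `𝒫_γ`: integrable, integral one, uniformly
Lipschitz, and all absolute moments finite. -/
def KernelBase (d : ℕ) (p : (Fin d → ℝ) → ℝ) : Prop :=
  Integrable p ∧ (∫ x, p x) = 1 ∧ (∃ L : ℝ≥0, LipschitzWith L p) ∧
  ∀ k : ℕ, Integrable fun x => ‖x‖ ^ k * |p x|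

/-- The kernel class `𝒫_γ` for finite `γ`. -/
def KernelFin (d : ℕ) (γ : ℝ) (p : (Fin d → ℝ) → ℝ) : Prop :=
  KernelBase d p ∧ IsHolder d γ p

/-- The kernel class `𝒫_∞`: the kernel extends to a bounded analytic function on the
strip of width `1` in `ℂ^d`. -/
def KernelInf (d : ℕ) (p : (Fin d → ℝ) → ℝ) : Prop :=
  KernelBase d p ∧
  ∃ P : (Fin d → ℂ) → ℂ, AnalyticOnNhd ℂ P (strip d 1) ∧
    (∃ B : ℝ, ∀ z ∈ strip d 1, ‖P z‖ ≤ B) ∧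
    ∀ x : Fin d → ℝ, P (fun j => (x j : ℂ)) = (p x : ℂ)

/-- The cube `𝒳 = [a,b]^d`. -/
def Xab (d : ℕ) (a b : ℝ) : Set (Fin d → ℝ) := Set.Icc (fun _ => a) fun _ => b

instance (d : ℕ) : CompactSpace (cube d) := isCompact_iff_compactSpace.mp isCompact_Icc

/-! ### Iterated differences -/

/-- The backward difference of `f` with step `h`. -/
def backDiff {E F : Type} [AddCommGroup E] [AddCommGroup F] (h : E) (f : E → F) : E → F :=
  fun x => f x - f (x - h)

/-- The iterated backward difference of `f` along a list of steps. -/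
def iterDiff {E F : Type} [AddCommGroup E] [AddCommGroup F] : List E → (E → F) → E → F
  | [], f => f
  | h :: hs, f => backDiff h (iterDiff hs f)

lemma iterDiff_backDiff {E F : Type} [AddCommGroup E] [AddCommGroup F] (hs : List E) (h : E)
    (f : E → F) : iterDiff hs (backDiff h f) = backDiff h (iterDiff hs f) := by
  induction hs with
  | nil => rfl
  | cons k hs ih =>
    simp only [iterDiff, ih]
    funext x
    simp only [backDiff, sub_right_comm x k h]
    abel

section Differentiable

variable {E F : Type} [NormedAddCommGroup E] [NormedSpace ℝ E]
  [NormedAddCommGroup F] [NormedSpace ℝ F]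

lemma Differentiable.backDiff {f : E → F} (hf : Differentiable ℝ f) (h : E) :
    Differentiable ℝ (backDiff h f) :=
  hf.sub (hf.comp (differentiable_id.sub_const h))

lemma fderiv_backDiff {f : E → F} (hf : Differentiable ℝ f) (h : E) :
    fderiv ℝ (backDiff h f) = backDiff h (fderiv ℝ f) := by
  funext x
  have h1 : DifferentiableAt ℝ (fun x => f (x - h)) x :=
    (hf.comp (differentiable_id.sub_const h)) x
  unfold _root_.backDiff
  rw [fderiv_fun_sub (hf x) h1, fderiv_comp_sub]

lemma Differentiable.iterDiff {f : E → F} (hf : Differentiable ℝ f) (hs : List E) :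
    Differentiable ℝ (iterDiff hs f) := by
  induction hs with
  | nil => exact hf
  | cons h hs ih => exact ih.backDiff h

lemma fderiv_iterDiff {f : E → F} (hf : Differentiable ℝ f) (hs : List E) :
    fderiv ℝ (iterDiff hs f) = iterDiff hs (fderiv ℝ f) := by
  induction hs with
  | nil => rfl
  | cons h hs ih => simp only [iterDiff]; rw [fderiv_backDiff (hf.iterDiff hs), ih]

lemma norm_iterDiff_le {E : Type} [NormedAddCommGroup E] [NormedSpace ℝ E] (hs : List E) :
    ∀ {F : Type} [NormedAddCommGroup F] [NormedSpace ℝ F] {f : E → F} {C : ℝ},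
      ContDiff ℝ hs.length f → (∀ x, ‖iteratedFDeriv ℝ hs.length f x‖ ≤ C) →
      ∀ x, ‖iterDiff hs f x‖ ≤ C * (hs.map norm).prod := by
  induction hs with
  | nil =>
    intro F _ _ f C _ hC x
    simpa [iterDiff] using hC x
  | cons h hs ih =>
    intro F _ _ f C hf hC x
    simp only [List.length_cons] at hf hC
    push_cast at hf
    have hd : Differentiable ℝ f := hf.differentiable (by simp)
    have hf' : ContDiff ℝ hs.length (fderiv ℝ f) := (contDiff_succ_iff_fderiv.1 hf).2.2
    have hb := ih hf' (C := C) (fun y => by rw [norm_iteratedFDeriv_fderiv]; exact hC y)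
    have := convex_univ.norm_image_sub_le_of_norm_fderiv_le (𝕜 := ℝ) (f := iterDiff hs f)
      (fun y _ => hd.iterDiff hs y) (fun y _ => by rw [fderiv_iterDiff hd]; exact hb y)
      (mem_univ (x - h)) (mem_univ x)
    simp only [iterDiff, backDiff, List.map_cons, List.prod_cons]
    refine this.trans (le_of_eq ?_)
    rw [sub_sub_cancel]
    ring

lemma iteratedFDeriv_backDiff {f : E → F} {n : ℕ} (hf : ContDiff ℝ n f) (h : E) :
    iteratedFDeriv ℝ n (backDiff h f) = backDiff h (iteratedFDeriv ℝ n f) := by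
  funext x
  have h1 : ContDiff ℝ n (fun x => f (x - h)) := hf.comp (contDiff_id.sub contDiff_const)
  unfold backDiff
  rw [fun_iteratedFDeriv_sub_apply hf.contDiffAt h1.contDiffAt, iteratedFDeriv_comp_sub]

lemma ContDiff.backDiff {f : E → F} {n : ℕ} (hf : ContDiff ℝ n f) (h : E) :
    ContDiff ℝ n (backDiff h f) :=
  hf.sub (hf.comp (contDiff_id.sub contDiff_const))

lemma norm_iterDiff_cons_le {f : E → F} {C θ : ℝ} (h : E) (hs : List E)
    (hf : ContDiff ℝ hs.length f)
    (hC : ∀ x y, ‖iteratedFDeriv ℝ hs.length f x - iteratedFDeriv ℝ hs.length f y‖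
      ≤ C * ‖x - y‖ ^ θ) (x : E) :
    ‖iterDiff (h :: hs) f x‖ ≤ C * ‖h‖ ^ θ * (hs.map norm).prod := by
  have := norm_iterDiff_le hs (hf.backDiff h) (C := C * ‖h‖ ^ θ) (fun y => by
    rw [iteratedFDeriv_backDiff hf]
    simpa [_root_.backDiff] using hC y (y - h)) x
  rwa [iterDiff_backDiff] at this

end Differentiable

/-! ### Smoothing by a kernel -/

section Smear

variable {d : ℕ} {p f : (Fin d → ℝ) → ℝ} {σ A : ℝ}

/-- The convolution of `f` with the kernel `p` at bandwidth `σ`. -/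
def smear (p : (Fin d → ℝ) → ℝ) (σ : ℝ) (f : (Fin d → ℝ) → ℝ) : (Fin d → ℝ) → ℝ :=
  fun x => ∫ u, p u * f (x - σ • u)

/-- The error made when approximating `f` by its convolution with `p`. -/
def bias (p : (Fin d → ℝ) → ℝ) (σ : ℝ) (f : (Fin d → ℝ) → ℝ) : (Fin d → ℝ) → ℝ :=
  fun x => f x - smear p σ f x

lemma integrable_mul_comp_sub_smul (hp : Integrable p) (hf : Continuous f) (hA : ∀ x, |f x| ≤ A)
    (x : Fin d → ℝ) : Integrable fun u => p u * f (x - σ • u) :=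
  hp.mul_bdd (c := A)
    (hf.comp (continuous_const.sub (continuous_const_smul σ))).aestronglyMeasurable
    (ae_of_all _ fun _ => hA _)

lemma continuous_smear (hp : Integrable p) (hf : Continuous f) (hA : ∀ x, |f x| ≤ A) :
    Continuous (smear p σ f) := by
  refine continuous_of_dominated (bound := fun u => |p u| * A)
    (fun x => (integrable_mul_comp_sub_smul hp hf hA x).aestronglyMeasurable)
    (fun x => ae_of_all _ fun u => ?_) (hp.abs.mul_const A) (ae_of_all _ fun u => ?_)
  · rw [Real.norm_eq_abs, abs_mul]
    exact mul_le_mul_of_nonneg_left (hA _) (abs_nonneg _)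
  · exact continuous_const.mul (hf.comp (continuous_id.sub continuous_const))

lemma abs_smear_le (hp : Integrable p) (hA : ∀ x, |f x| ≤ A) (x : Fin d → ℝ) :
    |smear p σ f x| ≤ A * ∫ u, |p u| := by
  rw [← Real.norm_eq_abs, smear, mul_comm, ← integral_mul_const]
  refine norm_integral_le_of_norm_le (hp.abs.mul_const A) (ae_of_all _ fun u => ?_)
  rw [Real.norm_eq_abs, abs_mul]
  exact mul_le_mul_of_nonneg_left (hA _) (abs_nonneg _)

lemma smear_add {g : (Fin d → ℝ) → ℝ} {B : ℝ} (hp : Integrable p)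
    (hf : Continuous f) (hA : ∀ x, |f x| ≤ A) (hg : Continuous g) (hB : ∀ x, |g x| ≤ B)
    (x : Fin d → ℝ) :
    smear p σ (fun y => f y + g y) x = smear p σ f x + smear p σ g x := by
  simp only [smear, mul_add]
  exact integral_add (integrable_mul_comp_sub_smul hp hf hA x)
    (integrable_mul_comp_sub_smul hp hg hB x)

lemma continuous_bias (hp : Integrable p) (hf : Continuous f) (hA : ∀ x, |f x| ≤ A) :
    Continuous (bias p σ f) :=
  hf.sub (continuous_smear hp hf hA)

lemma abs_bias_le (hp : Integrable p) (hA : ∀ x, |f x| ≤ A) (x : Fin d → ℝ) :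
    |bias p σ f x| ≤ A * (1 + ∫ u, |p u|) := by
  rw [mul_add, mul_one]
  exact (abs_sub _ _).trans (add_le_add (hA x) (abs_smear_le hp hA x))

lemma bias_eq_integral_backDiff (hp : Integrable p) (h1 : ∫ u, p u = 1)
    (hf : Continuous f) (hA : ∀ x, |f x| ≤ A) (x : Fin d → ℝ) :
    bias p σ f x = ∫ u, p u * backDiff (σ • u) f x := by
  simp only [backDiff, mul_sub]
  rw [integral_sub (hp.mul_const _) (integrable_mul_comp_sub_smul hp hf hA x),
    integral_mul_const, h1, one_mul]
  rfl

lemma Continuous.backDiff (hf : Continuous f) (h : Fin d → ℝ) : Continuous (backDiff h f) :=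
  hf.sub (hf.comp (continuous_id.sub continuous_const))

lemma abs_backDiff_le (hA : ∀ x, |f x| ≤ A) (h x : Fin d → ℝ) : |backDiff h f x| ≤ A + A :=
  (abs_sub _ _).trans (add_le_add (hA _) (hA _))

lemma exists_continuous_abs_iterDiff_le (hf : Continuous f) (hA : ∀ x, |f x| ≤ A)
    (hs : List (Fin d → ℝ)) :
    Continuous (iterDiff hs f) ∧ ∃ B, ∀ x, |iterDiff hs f x| ≤ B := by
  induction hs with
  | nil => exact ⟨hf, A, hA⟩
  | cons h hs ih =>
    obtain ⟨hc, B, hB⟩ := ih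
    exact ⟨hc.backDiff h, B + B, abs_backDiff_le hB h⟩

lemma backDiff_bias (hp : Integrable p) (hf : Continuous f) (hA : ∀ x, |f x| ≤ A)
    (h : Fin d → ℝ) : backDiff h (bias p σ f) = bias p σ (backDiff h f) := by
  funext x
  have : smear p σ (backDiff h f) x = smear p σ f x - smear p σ f (x - h) := by
    simp only [smear, backDiff, mul_sub]
    rw [← integral_sub (integrable_mul_comp_sub_smul hp hf hA x)
      (integrable_mul_comp_sub_smul hp hf hA (x - h))]
    simp only [sub_right_comm]
  change bias p σ f x - bias p σ f (x - h) = backDiff h f x - smear p σ (backDiff h f) x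
  rw [this]
  simp only [bias, backDiff]
  ring

lemma iterDiff_bias (hp : Integrable p) (hf : Continuous f) (hA : ∀ x, |f x| ≤ A)
    (hs : List (Fin d → ℝ)) : iterDiff hs (bias p σ f) = bias p σ (iterDiff hs f) := by
  induction hs with
  | nil => rfl
  | cons h hs ih =>
    obtain ⟨hc, B, hB⟩ := exists_continuous_abs_iterDiff_le hf hA hs
    simp only [iterDiff]
    rw [ih, backDiff_bias hp hc hB]

/-- If `p` has a finite moment of order `θ`, each application of `bias p σ` gains a factor `σ ^ θ`
over a Hölder bound on differences. -/
lemma abs_iterDiff_bias_le (hp : Integrable p) (h1 : ∫ u, p u = 1)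
    (hf : Continuous f) (hA : ∀ x, |f x| ≤ A) (hσ : 0 ≤ σ) {C θ : ℝ}
    (hθ : Integrable fun u => ‖u‖ ^ θ * |p u|) {hs : List (Fin d → ℝ)}
    (hC : ∀ h x, |iterDiff (h :: hs) f x| ≤ C * ‖h‖ ^ θ * (hs.map norm).prod)
    (x : Fin d → ℝ) :
    |iterDiff hs (bias p σ f) x| ≤
      C * (σ ^ θ * ∫ u, ‖u‖ ^ θ * |p u|) * (hs.map norm).prod := by
  obtain ⟨hc, B, hB⟩ := exists_continuous_abs_iterDiff_le hf hA hs
  rw [iterDiff_bias hp hf hA, bias_eq_integral_backDiff hp h1 hc hB, ← Real.norm_eq_abs]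
  have : C * (σ ^ θ * ∫ u, ‖u‖ ^ θ * |p u|) * (hs.map norm).prod
      = ∫ u, (C * σ ^ θ * (hs.map norm).prod) * (‖u‖ ^ θ * |p u|) := by
    rw [integral_const_mul]; ring
  rw [this]
  refine norm_integral_le_of_norm_le (hθ.const_mul _) (ae_of_all _ fun u => ?_)
  rw [Real.norm_eq_abs, abs_mul]
  refine (mul_le_mul_of_nonneg_left (hC (σ • u) x) (abs_nonneg _)).trans (le_of_eq ?_)
  rw [norm_smul, Real.norm_of_nonneg hσ, Real.mul_rpow hσ (norm_nonneg u)]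
  ring

lemma abs_iterate_bias_le_of_lipschitz_differences (hp : Integrable p) (h1 : ∫ u, p u = 1)
    (hσ : 0 ≤ σ) (hM : Integrable fun u => ‖u‖ * |p u|) (n : ℕ) :
    ∀ {f : (Fin d → ℝ) → ℝ} {A C : ℝ}, Continuous f → (∀ x, |f x| ≤ A) →
      (∀ hs : List (Fin d → ℝ), hs.length = n → ∀ x, |iterDiff hs f x| ≤ C * (hs.map norm).prod) →
      ∀ x, |(bias p σ)^[n] f x| ≤ C * (σ * ∫ u, ‖u‖ * |p u|) ^ n := by
  induction n with
  | zero =>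
    intro f A C hf hA hC x
    simpa [iterDiff] using hC [] rfl x
  | succ n ih =>
    intro f A C hf hA hC x
    rw [Function.iterate_succ_apply]
    refine (ih (C := C * (σ * ∫ u, ‖u‖ * |p u|)) (continuous_bias hp hf hA) (abs_bias_le hp hA)
      (fun hs hl y => ?_) x).trans (le_of_eq (by ring))
    have := abs_iterDiff_bias_le hp h1 hf hA hσ (C := C) (θ := 1) (hs := hs)
      (by simpa using hM) (fun h y => by
        refine (hC (h :: hs) (by simp [hl]) y).trans (le_of_eq ?_)
        simp [mul_assoc]) y
    simpa using this

lemma abs_iterate_bias_le (hp : Integrable p) (h1 : ∫ u, p u = 1)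
    (hσ : 0 ≤ σ) (hM : Integrable fun u => ‖u‖ * |p u|) {n : ℕ} {C θ : ℝ}
    (hθ : Integrable fun u => ‖u‖ ^ θ * |p u|) (hA : ∀ x, |f x| ≤ A) (hf : ContDiff ℝ n f)
    (hC : ∀ x y, ‖iteratedFDeriv ℝ n f x - iteratedFDeriv ℝ n f y‖ ≤ C * ‖x - y‖ ^ θ)
    (x : Fin d → ℝ) :
    |(bias p σ)^[n + 1] f x| ≤
      C * (σ ^ θ * ∫ u, ‖u‖ ^ θ * |p u|) * (σ * ∫ u, ‖u‖ * |p u|) ^ n := by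
  rw [Function.iterate_succ_apply]
  refine abs_iterate_bias_le_of_lipschitz_differences hp h1 hσ hM n
    (continuous_bias hp hf.continuous hA) (abs_bias_le hp hA) (fun hs hl y => ?_) x
  subst hl
  exact abs_iterDiff_bias_le hp h1 hf.continuous hA hσ hθ
    (fun h z => norm_iterDiff_cons_le h hs hf hC z) y

lemma exists_continuous_iterate_bias_bound (hp : Integrable p) (hf : Continuous f)
    (hA : ∀ x, |f x| ≤ A) (n : ℕ) :
    ∃ B, ∀ σ : ℝ, Continuous ((bias p σ)^[n] f) ∧ ∀ x, |(bias p σ)^[n] f x| ≤ B := by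
  induction n with
  | zero => exact ⟨A, fun σ => ⟨hf, hA⟩⟩
  | succ n ih =>
    obtain ⟨B, hB⟩ := ih
    refine ⟨B * (1 + ∫ u, |p u|), fun σ => ?_⟩
    rw [Function.iterate_succ_apply']
    exact ⟨continuous_bias hp (hB σ).1 (hB σ).2, abs_bias_le hp (hB σ).2⟩

/-- Inverting the smoothing operator up to an iterated bias, with a bound uniform in `σ`. -/
lemma exists_smear_eq_sub_iterate_bias (hp : Integrable p) (hf : Continuous f)
    (hA : ∀ x, |f x| ≤ A) (n : ℕ) :
    ∃ V, ∀ σ : ℝ, ∃ v : (Fin d → ℝ) → ℝ, Continuous v ∧ (∀ x, |v x| ≤ V) ∧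
      ∀ x, smear p σ v x = f x - (bias p σ)^[n] f x := by
  induction n with
  | zero => exact ⟨0, fun σ => ⟨0, continuous_const, by simp, by simp [smear]⟩⟩
  | succ n ih =>
    obtain ⟨V, hV⟩ := ih
    obtain ⟨B, hB⟩ := exists_continuous_iterate_bias_bound hp hf hA n
    refine ⟨V + B, fun σ => ?_⟩
    obtain ⟨v, hc, hv, hs⟩ := hV σ
    refine ⟨fun y => v y + (bias p σ)^[n] f y, hc.add (hB σ).1,
      fun x => (abs_add_le _ _).trans (add_le_add (hv x) ((hB σ).2 x)), fun x => ?_⟩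
    rw [smear_add hp hc hv (hB σ).1 (hB σ).2, hs, Function.iterate_succ_apply', bias]
    ring

end Smear

/-! ### Discretisation on a grid -/

section Grid

variable {d : ℕ}

/-- The half-open grid cell of side `1 / m` with upper corner `k / m`. -/
def gridCell (d m : ℕ) (k : Fin d → ℕ) : Set (Fin d → ℝ) :=
  Set.pi univ fun j => Ioc (((k j : ℝ) - 1) / m) ((k j : ℝ) / m)

lemma measurableSet_gridCell (m : ℕ) (k : Fin d → ℕ) : MeasurableSet (gridCell d m k) :=
  MeasurableSet.univ_pi fun _ => measurableSet_Ioc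

lemma volume_gridCell {m : ℕ} (k : Fin d → ℕ) :
    volume (gridCell d m k) = ENNReal.ofReal ((m : ℝ)⁻¹ ^ d) := by
  rw [gridCell, Real.volume_pi_Ioc, ENNReal.ofReal_pow (by positivity)]
  simp [← sub_div]

lemma measureReal_gridCell {m : ℕ} (k : Fin d → ℕ) :
    volume.real (gridCell d m k) = (m : ℝ)⁻¹ ^ d := by
  rw [measureReal_def, volume_gridCell, ENNReal.toReal_ofReal (by positivity)]

lemma mem_gridCell_iff {m : ℕ} (hm : 1 ≤ m) {k : Fin d → ℕ} {y : Fin d → ℝ} (hk : ∀ j, 1 ≤ k j) :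
    y ∈ gridCell d m k ↔ ∀ j, ⌈(m : ℝ) * y j⌉₊ = k j := by
  have hm' : (0 : ℝ) < m := by exact_mod_cast hm
  simp only [gridCell, mem_univ_pi, mem_Ioc]
  refine forall_congr' fun j => ?_
  rw [Nat.ceil_eq_iff (by have := hk j; omega), div_lt_iff₀ hm', le_div_iff₀ hm',
    Nat.cast_sub (hk j), Nat.cast_one, mul_comm]

lemma pairwise_disjoint_gridCell {m : ℕ} (hm : 1 ≤ m) :
    Set.Pairwise (↑(Fintype.piFinset fun _ : Fin d => Finset.Icc 1 m) : Set (Fin d → ℕ))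
      (Function.onFun Disjoint (gridCell d m)) := by
  intro k hk l hl hkl
  simp only [Finset.mem_coe, Fintype.mem_piFinset, Finset.mem_Icc] at hk hl
  refine Set.disjoint_left.2 fun y hy hy' => hkl (funext fun j => ?_)
  rw [← (mem_gridCell_iff hm fun j => (hk j).1).1 hy j,
    (mem_gridCell_iff hm fun j => (hl j).1).1 hy' j]

lemma mem_biUnion_gridCell {m : ℕ} (hm : 1 ≤ m) {y : Fin d → ℝ}
    (hy : ∀ j, 0 < y j ∧ y j ≤ 1) :
    y ∈ ⋃ k ∈ Fintype.piFinset fun _ : Fin d => Finset.Icc 1 m, gridCell d m k := by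
  have hm' : (0 : ℝ) < m := by exact_mod_cast hm
  have h1 : ∀ j, 1 ≤ ⌈(m : ℝ) * y j⌉₊ := fun j => Nat.ceil_pos.2 (mul_pos hm' (hy j).1)
  refine mem_iUnion₂.2 ⟨fun j => ⌈(m : ℝ) * y j⌉₊, ?_, (mem_gridCell_iff hm h1).2 fun _ => rfl⟩
  simp only [Fintype.mem_piFinset, Finset.mem_Icc]
  exact fun j => ⟨h1 j, Nat.ceil_le.2 (mul_le_of_le_one_right hm'.le (hy j).2)⟩

lemma norm_sub_le_of_mem_gridCell {m : ℕ} {k : Fin d → ℕ} {y : Fin d → ℝ}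
    (hy : y ∈ gridCell d m k) : ‖y - fun j => (k j : ℝ) / m‖ ≤ (m : ℝ)⁻¹ := by
  refine (pi_norm_le_iff_of_nonneg (by positivity)).2 fun j => ?_
  obtain ⟨h1, h2⟩ := hy j trivial
  rw [sub_div] at h1
  rw [Pi.sub_apply, Real.norm_eq_abs, abs_le, inv_eq_one_div]
  constructor <;> linarith [show (0 : ℝ) ≤ 1 / m by positivity]

lemma card_grid (d m : ℕ) :
    ((Fintype.piFinset fun _ : Fin d => Finset.Icc 1 m).card : ℝ) = (m : ℝ) ^ d := by
  simp

/-- A Riemann sum with averaged weights approximates the integral over the grid. -/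
lemma abs_sum_gridCell_sub_le {m : ℕ} (hm : 1 ≤ m) {v q : (Fin d → ℝ) → ℝ} {V L : ℝ}
    (hL : 0 ≤ L) (hv : Continuous v) (hV : ∀ y, |v y| ≤ V)
    (hvq : Integrable fun y => v y * q y) (hq : ∀ y z, |q y - q z| ≤ L * ‖y - z‖) :
    |(∑ k ∈ Fintype.piFinset fun _ : Fin d => Finset.Icc 1 m,
        (∫ y in gridCell d m k, v y) * q (fun j => (k j : ℝ) / m)) -
      ∫ y in ⋃ k ∈ Fintype.piFinset fun _ : Fin d => Finset.Icc 1 m, gridCell d m k, v y * q y|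
      ≤ V * L / m := by
  have hm' : (m : ℝ) ≠ 0 := by positivity
  rw [integral_biUnion_finset _ (fun k _ => measurableSet_gridCell m k)
    (pairwise_disjoint_gridCell hm) (fun k _ => hvq.integrableOn), ← Finset.sum_sub_distrib]
  have key : ∀ k ∈ Fintype.piFinset fun _ : Fin d => Finset.Icc 1 m,
      |(∫ y in gridCell d m k, v y) * q (fun j => (k j : ℝ) / m) -
        ∫ y in gridCell d m k, v y * q y| ≤ V * (L * (m : ℝ)⁻¹) * (m : ℝ)⁻¹ ^ d := by
    intro k _
    have hfin : volume (gridCell d m k) < ∞ := by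
      rw [volume_gridCell]; exact ENNReal.ofReal_lt_top
    have hvi : IntegrableOn v (gridCell d m k) :=
      Measure.integrableOn_of_bounded hfin.ne hv.aestronglyMeasurable (ae_of_all _ hV)
    rw [← integral_mul_const, ← integral_sub (hvi.mul_const _) hvq.integrableOn,
      ← measureReal_gridCell k, ← Real.norm_eq_abs]
    refine norm_setIntegral_le_of_norm_le_const hfin fun y hy => ?_
    rw [← mul_sub, Real.norm_eq_abs, abs_mul]
    refine mul_le_mul (hV y) ?_ (abs_nonneg _) ((abs_nonneg _).trans (hV y))
    rw [abs_sub_comm]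
    exact (hq _ _).trans (mul_le_mul_of_nonneg_left (norm_sub_le_of_mem_gridCell hy) hL)
  refine (Finset.abs_sum_le_sum_abs _ _).trans ((Finset.sum_le_sum key).trans (le_of_eq ?_))
  rw [Finset.sum_const, nsmul_eq_mul, card_grid, inv_pow]
  field_simp

lemma mul_sum_sq_setIntegral_gridCell_le {m : ℕ} (hm : 1 ≤ m) {v : (Fin d → ℝ) → ℝ} {V : ℝ}
    (hV : ∀ y, |v y| ≤ V) :
    (m : ℝ) ^ d * ∑ k ∈ Fintype.piFinset fun _ : Fin d => Finset.Icc 1 m,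
      (∫ y in gridCell d m k, v y) ^ 2 ≤ V ^ 2 := by
  have hm' : (m : ℝ) ≠ 0 := by positivity
  have key : ∀ k ∈ Fintype.piFinset fun _ : Fin d => Finset.Icc 1 m,
      (∫ y in gridCell d m k, v y) ^ 2 ≤ (V * (m : ℝ)⁻¹ ^ d) ^ 2 := by
    intro k _
    refine sq_le_sq' (neg_le_of_abs_le ?_) (le_of_abs_le ?_) <;>
    · rw [← measureReal_gridCell k, ← Real.norm_eq_abs]
      exact norm_setIntegral_le_of_norm_le_const
        (by rw [volume_gridCell]; exact ENNReal.ofReal_lt_top) fun y _ => hV y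
  refine (mul_le_mul_of_nonneg_left (Finset.sum_le_sum key) (by positivity)).trans (le_of_eq ?_)
  rw [Finset.sum_const, nsmul_eq_mul, card_grid, inv_pow]
  field_simp

end Grid

/-! ### The rescaled kernel -/

section Rescale

variable {d : ℕ} {p : (Fin d → ℝ) → ℝ} {σ : ℝ}

lemma integral_rescale (hσ : 0 < σ) (F : (Fin d → ℝ) → ℝ) (x : Fin d → ℝ) :
    ∫ y, 1 / σ ^ d * F (σ⁻¹ • (x - y)) = ∫ u, F u := by
  rw [integral_const_mul, integral_sub_left_eq_self (fun z => F (σ⁻¹ • z)) volume x,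
    Measure.integral_comp_inv_smul_of_nonneg _ _ hσ.le]
  simp [hσ.ne']

lemma Integrable.rescale {F : (Fin d → ℝ) → ℝ} (hF : Integrable F) (hσ : 0 < σ)
    (x : Fin d → ℝ) : Integrable fun y => 1 / σ ^ d * F (σ⁻¹ • (x - y)) :=
  ((hF.comp_smul (inv_ne_zero hσ.ne')).comp_sub_left x).const_mul _

lemma smear_eq_integral_rescale (hσ : 0 < σ) (v : (Fin d → ℝ) → ℝ) (x : Fin d → ℝ) :
    smear p σ v x = ∫ y, v y * (1 / σ ^ d * p (σ⁻¹ • (x - y))) := by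
  rw [smear, ← integral_rescale hσ _ x]
  refine integral_congr_ae (ae_of_all _ fun y => ?_)
  simp only [smul_inv_smul₀ hσ.ne', sub_sub_cancel]
  ring

lemma abs_rescale_sub_le {L : ℝ≥0} (hL : LipschitzWith L p) (hσ : 0 < σ) (x y z : Fin d → ℝ) :
    |1 / σ ^ d * p (σ⁻¹ • (x - y)) - 1 / σ ^ d * p (σ⁻¹ • (x - z))| ≤
      L / σ ^ (1 + d) * ‖y - z‖ := by
  have h := hL.dist_le_mul (σ⁻¹ • (x - y)) (σ⁻¹ • (x - z))
  rw [Real.dist_eq, dist_eq_norm, ← smul_sub, norm_smul, Real.norm_of_nonneg (inv_pos.2 hσ).le,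
    sub_sub_sub_cancel_left, norm_sub_rev] at h
  rw [← mul_sub, abs_mul, abs_of_nonneg (by positivity : (0 : ℝ) ≤ 1 / σ ^ d)]
  refine (mul_le_mul_of_nonneg_left h (by positivity)).trans (le_of_eq ?_)
  rw [pow_add]
  field_simp

/-- The part of a smoothed function coming from points at distance at least `δ` is small. -/
lemma abs_setIntegral_rescale_le {δ V : ℝ} (hσ : 0 < σ) (hδ : 0 < δ) (n : ℕ)
    (hM : Integrable fun u => ‖u‖ ^ n * |p u|) {v : (Fin d → ℝ) → ℝ} (hV : ∀ y, |v y| ≤ V)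
    {x : Fin d → ℝ} {s : Set (Fin d → ℝ)} (hs : MeasurableSet s)
    (hx : ∀ y ∈ s, δ ≤ ‖x - y‖) :
    |∫ y in s, v y * (1 / σ ^ d * p (σ⁻¹ • (x - y)))| ≤
      V * (σ / δ) ^ n * ∫ u, ‖u‖ ^ n * |p u| := by
  have hV0 : 0 ≤ V := (abs_nonneg _).trans (hV x)
  have hi := (Integrable.rescale hM hσ x).const_mul (V * (σ / δ) ^ n)
  rw [← integral_rescale hσ (fun u => ‖u‖ ^ n * |p u|) x, ← integral_const_mul,
    ← Real.norm_eq_abs]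
  refine (norm_integral_le_of_norm_le hi.integrableOn
    ((ae_restrict_iff' hs).2 (ae_of_all _ fun y hy => ?_))).trans
    (setIntegral_le_integral hi (ae_of_all _ fun y => by simp only [Pi.zero_apply]; positivity))
  have h1 : 1 ≤ (σ / δ) ^ n * ‖σ⁻¹ • (x - y)‖ ^ n := by
    rw [← mul_pow, norm_smul, Real.norm_of_nonneg (inv_pos.2 hσ).le]
    refine one_le_pow₀ ?_
    have : σ / δ * (σ⁻¹ * ‖x - y‖) = ‖x - y‖ / δ := by field_simp
    rw [this, one_le_div hδ]
    exact hx y hy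
  have h2 : 0 ≤ 1 / σ ^ d * |p (σ⁻¹ • (x - y))| := by positivity
  rw [Real.norm_eq_abs, abs_mul, abs_mul, abs_of_nonneg (by positivity : (0 : ℝ) ≤ 1 / σ ^ d)]
  calc |v y| * (1 / σ ^ d * |p (σ⁻¹ • (x - y))|)
      ≤ V * (1 / σ ^ d * |p (σ⁻¹ • (x - y))|) := mul_le_mul_of_nonneg_right (hV y) h2
    _ ≤ V * (((σ / δ) ^ n * ‖σ⁻¹ • (x - y)‖ ^ n) * (1 / σ ^ d * |p (σ⁻¹ • (x - y))|)) :=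
        mul_le_mul_of_nonneg_left (le_mul_of_one_le_left h2 h1) hV0
    _ = _ := by ring

end Rescale

lemma le_norm_sub_of_not_mem_unit {d : ℕ} {a b : ℝ} {x y : Fin d → ℝ} (hx : x ∈ Xab d a b)
    (hy : ¬∀ j, 0 < y j ∧ y j ≤ 1) : min a (1 - b) ≤ ‖x - y‖ := by
  push Not at hy
  obtain ⟨j, hj⟩ := hy
  have h1 : a ≤ x j := hx.1 j
  have h2 : x j ≤ b := hx.2 j
  refine le_trans ?_ (norm_le_pi_norm (x - y) j)
  rw [Pi.sub_apply, Real.norm_eq_abs]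
  rcases le_or_gt (y j) 0 with h | h
  · exact (min_le_left _ _).trans ((by linarith : a ≤ x j - y j).trans (le_abs_self _))
  · have := hj h
    exact (min_le_right _ _).trans ((by linarith : 1 - b ≤ -(x j - y j)).trans (neg_le_abs _))

lemma lint_lt {α : ℝ} (hα : 0 < α) : (lint α : ℝ) < α := by
  have h : 0 < ⌈α⌉₊ := Nat.ceil_pos.2 hα
  exact Nat.lt_ceil.1 (show lint α < ⌈α⌉₊ by unfold lint; omega)

lemma le_lint_add_one {α : ℝ} (hα : 0 < α) : α ≤ ((lint α + 1 : ℕ) : ℝ) := by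
  have h : 0 < ⌈α⌉₊ := Nat.ceil_pos.2 hα
  exact Nat.ceil_le.1 (show ⌈α⌉₊ ≤ lint α + 1 by unfold lint; omega)

lemma KernelBase.integrable_norm_rpow_mul {d : ℕ} {p : (Fin d → ℝ) → ℝ} (hp : KernelBase d p)
    {θ : ℝ} (h0 : 0 ≤ θ) (h1 : θ ≤ 1) : Integrable fun u => ‖u‖ ^ θ * |p u| := by
  refine Integrable.mono' (hp.1.abs.add (hp.2.2.2 1)) ?_ (ae_of_all _ fun u => ?_)
  · exact (continuous_norm.rpow_const fun _ => Or.inr h0).aestronglyMeasurable.mul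
      hp.1.abs.aestronglyMeasurable
  · rw [Real.norm_of_nonneg (by positivity)]
    simp only [Pi.add_apply, pow_one]
    rw [← one_add_mul]
    refine mul_le_mul_of_nonneg_right ?_ (abs_nonneg _)
    rcases le_total ‖u‖ 1 with h | h
    · linarith [Real.rpow_le_one (norm_nonneg u) h h0, norm_nonneg u]
    · linarith [(Real.rpow_le_rpow_of_exponent_le h h1).trans_eq (Real.rpow_one _)]

/-- For each bandwidth there is a bounded density, with bound uniform in the bandwidth, whose
convolution with the kernel is within `O(σ ^ α)` of a given `α`-Hölder function. -/
lemma KernelBase.exists_smear_approx {d : ℕ} {p g : (Fin d → ℝ) → ℝ} (hp : KernelBase d p)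
    {α : ℝ} (hα : 0 < α) (hg : IsHolder d α g) :
    ∃ V K : ℝ, 0 ≤ V ∧ 0 ≤ K ∧ ∀ σ : ℝ, 0 < σ → ∃ v : (Fin d → ℝ) → ℝ,
      Continuous v ∧ (∀ y, |v y| ≤ V) ∧ ∀ x, |smear p σ v x - g x| ≤ K * σ ^ α := by
  obtain ⟨hgd, hgb, C, hC⟩ := hg
  obtain ⟨A, hA'⟩ := hgb 0 (Nat.zero_le _)
  have hA : ∀ x, |g x| ≤ A := fun x => by simpa using hA' x
  have hβ := lint_lt hα
  have hθ := hp.integrable_norm_rpow_mul (θ := α - lint α) (by linarith)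
    (by have := le_lint_add_one hα; push_cast at this; linarith)
  have hM : Integrable fun u => ‖u‖ * |p u| := by simpa using hp.2.2.2 1
  obtain ⟨V, hV⟩ := exists_smear_eq_sub_iterate_bias hp.1 hgd.continuous hA (lint α + 1)
  have hV0 : 0 ≤ V := by
    obtain ⟨v, -, hv, -⟩ := hV 0
    exact (abs_nonneg _).trans (hv 0)
  have hC' : ∀ x y, ‖iteratedFDeriv ℝ (lint α) g x - iteratedFDeriv ℝ (lint α) g y‖ ≤
      |C| * ‖x - y‖ ^ (α - (lint α : ℝ)) := fun x y =>
    (hC x y).trans (mul_le_mul_of_nonneg_right (le_abs_self C) (by positivity))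
  refine ⟨V, |C| * (∫ u, ‖u‖ ^ (α - (lint α : ℝ)) * |p u|) * (∫ u, ‖u‖ * |p u|) ^ lint α,
    hV0, by positivity, fun σ hσ => ?_⟩
  obtain ⟨v, hc, hv, hs⟩ := hV σ
  refine ⟨v, hc, hv, fun x => ?_⟩
  rw [hs, sub_sub_cancel_left, abs_neg]
  refine (abs_iterate_bias_le hp.1 hp.2.1 hσ.le hM hθ hA hgd hC' x).trans (le_of_eq ?_)
  have : σ ^ α = σ ^ (α - (lint α : ℝ)) * σ ^ lint α := by
    rw [← Real.rpow_natCast σ (lint α), ← Real.rpow_add hσ, sub_add_cancel]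
  rw [this]
  ring

/-- **Lemma 3.5.** For `p ∈ 𝒫_γ` (`γ ∈ (d/2,∞]`) and `w₀ ∈ C^α(𝒳)` there are
constants `K₇, K₈, K₉ > 0`, independent of `σ` and `m`, such that for all `σ > 0` and
`m ∈ ℕ` there are weights `(w_k)` with `m^d ∑_k w_k² ≤ K₇²(1∨σ)²` (i.e. the mixture
`h = ∑_k w_k σ^{-d} p((·-k/m)/σ)` has RKHS norm `≤ K₇(1∨σ)`) and
`sup_{x∈𝒳} |h(x) - w₀(x)| ≤ K₈(1∨σ^{β+1}) σ^{-(1+d)} m^{-(α-β)} + K₉ σ^α`,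
where `β` is the largest integer strictly smaller than `α`. -/
theorem rkhs_approximation
    {d : ℕ} (hd : 0 < d) {p : (Fin d → ℝ) → ℝ}
    (hp : (∃ γ : ℝ, (d : ℝ) / 2 < γ ∧ KernelFin d γ p) ∨ KernelInf d p)
    {α : ℝ} (hα : 0 < α)
    {a b : ℝ} (ha : 0 < a) (hab : a < b) (hb : b < 1)
    {w₀ : (Fin d → ℝ) → ℝ} (hw₀ : HolderOn d α w₀ (Xab d a b)) :
    ∃ K₇ K₈ K₉ : ℝ, 0 < K₇ ∧ 0 < K₈ ∧ 0 < K₉ ∧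
      ∀ σ : ℝ, 0 < σ → ∀ m : ℕ, 1 ≤ m →
        ∃ w : (Fin d → ℕ) → ℝ,
          (m : ℝ) ^ d * ∑ k ∈ Fintype.piFinset fun _ : Fin d => Finset.Icc 1 m, (w k) ^ 2
            ≤ K₇ ^ 2 * (max 1 σ) ^ 2 ∧
          ∀ x ∈ Xab d a b,
            |(∑ k ∈ Fintype.piFinset fun _ : Fin d => Finset.Icc 1 m,
                w k * (1 / σ ^ d) * p (fun j => (x j - (k j : ℝ) / (m : ℝ)) / σ)) - w₀ x|
              ≤ K₈ * max 1 (σ ^ (lint α + 1)) / (σ ^ (1 + d) * (m : ℝ) ^ (α - (lint α : ℝ)))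
                + K₉ * σ ^ α := by
  have hpB : KernelBase d p := by
    rcases hp with ⟨γ, -, h⟩ | h <;> exact h.1
  obtain ⟨g, hg, hgw⟩ := hw₀
  obtain ⟨V, K, hV0, hK0, hsm⟩ := hpB.exists_smear_approx hα hg
  obtain ⟨hp1, -, ⟨L, hL⟩, hmom⟩ := hpB
  obtain ⟨A, hA⟩ := hg.2.1 0 (Nat.zero_le _)
  simp only [norm_iteratedFDeriv_zero, Real.norm_eq_abs] at hA
  have hA0 : 0 ≤ A := (abs_nonneg _).trans (hA 0)
  set n := lint α + 1 with hn
  set δ := min a (1 - b) with hδ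
  have hδ0 : 0 < δ := lt_min ha (by linarith)
  set M := ∫ u, ‖u‖ ^ n * |p u| with hM
  have hM0 : 0 ≤ M := integral_nonneg fun u => by positivity
  refine ⟨V + 1, V * L + 1, V * (δ⁻¹ ^ n * M) + K + A + 1, by positivity, by positivity,
    by positivity, fun σ hσ m hm => ?_⟩
  have hm' : (1 : ℝ) ≤ m := by exact_mod_cast hm
  have hm0 : (0 : ℝ) < m := by linarith
  rcases le_or_gt 1 σ with h1 | h1
  · refine ⟨0, by simp; positivity, fun x hx => ?_⟩
    have hσα : 1 ≤ σ ^ α := Real.one_le_rpow h1 hα.le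
    simp only [Pi.zero_apply, zero_mul, Finset.sum_const_zero, zero_sub, abs_neg, hgw hx]
    calc |g x| ≤ A * 1 := by simpa using hA x
      _ ≤ (V * (δ⁻¹ ^ n * M) + K + A + 1) * σ ^ α := by
        refine mul_le_mul ?_ hσα zero_le_one (by positivity)
        linarith [show 0 ≤ V * (δ⁻¹ ^ n * M) by positivity]
      _ ≤ _ := le_add_of_nonneg_left (by positivity)
  · obtain ⟨v, hvc, hvV, hv⟩ := hsm σ hσ
    refine ⟨fun k => ∫ y in gridCell d m k, v y, ?_, fun x hx => ?_⟩
    · rw [max_eq_left h1.le, one_pow, mul_one]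
      exact (mul_sum_sq_setIntegral_gridCell_le hm hvV).trans
        (pow_le_pow_left₀ hV0 (by linarith) 2)
    rw [hgw hx, max_eq_left (pow_le_one₀ hσ.le h1.le), mul_one]
    set q : (Fin d → ℝ) → ℝ := fun y => 1 / σ ^ d * p (σ⁻¹ • (x - y)) with hq
    set Q := ⋃ k ∈ Fintype.piFinset fun _ : Fin d => Finset.Icc 1 m, gridCell d m k with hQ
    have hQm : MeasurableSet Q :=
      Finset.measurableSet_biUnion _ fun k _ => measurableSet_gridCell m k
    have hvq : Integrable fun y => v y * q y :=
      (Integrable.rescale hp1 hσ x).bdd_mul (c := V) hvc.aestronglyMeasurable (ae_of_all _ hvV)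
    have hsum : ∑ k ∈ Fintype.piFinset fun _ : Fin d => Finset.Icc 1 m,
        (∫ y in gridCell d m k, v y) * (1 / σ ^ d) *
          p (fun j => (x j - (k j : ℝ) / (m : ℝ)) / σ) =
        ∑ k ∈ Fintype.piFinset fun _ : Fin d => Finset.Icc 1 m,
        (∫ y in gridCell d m k, v y) * q (fun j => (k j : ℝ) / m) := by
      refine Finset.sum_congr rfl fun k _ => ?_
      rw [mul_assoc, hq]
      congr 3
      funext j
      simp only [Pi.smul_apply, Pi.sub_apply, smul_eq_mul]
      rw [div_eq_inv_mul]
    have e1 := abs_sum_gridCell_sub_le hm (by positivity) hvc hvV hvq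
      (abs_rescale_sub_le hL hσ x)
    have e2 := abs_setIntegral_rescale_le hσ hδ0 n (hmom n) hvV (x := x) (s := Qᶜ) hQm.compl
      fun y hy => le_norm_sub_of_not_mem_unit hx fun h => hy (mem_biUnion_gridCell hm h)
    have e3 := hv x
    rw [smear_eq_integral_rescale hσ, ← integral_add_compl hQm hvq] at e3
    rw [hsum]
    have b1 : V * (L / σ ^ (1 + d)) / m ≤
        (V * L + 1) / (σ ^ (1 + d) * (m : ℝ) ^ (α - (lint α : ℝ))) := by
      have hmθ : (m : ℝ) ^ (α - (lint α : ℝ)) ≤ m := by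
        refine (Real.rpow_le_rpow_of_exponent_le hm' (y := α - lint α) (z := 1) ?_).trans_eq
          (Real.rpow_one _)
        have := le_lint_add_one hα
        push_cast at this
        linarith
      have : V * (L / σ ^ (1 + d)) / m = V * L / (σ ^ (1 + d) * m) := by field_simp
      rw [this]
      gcongr
      linarith
    have b2 : V * (σ / δ) ^ n * M ≤ V * (δ⁻¹ ^ n * M) * σ ^ α := by
      have : V * (σ / δ) ^ n * M = V * (δ⁻¹ ^ n * M) * σ ^ n := by
        rw [div_eq_mul_inv, mul_pow]; ring
      rw [this]
      refine mul_le_mul_of_nonneg_left ?_ (by positivity)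
      rw [← Real.rpow_natCast σ n]
      exact Real.rpow_le_rpow_of_exponent_ge hσ h1.le (le_lint_add_one hα)
    have b3 : 0 ≤ (A + 1) * σ ^ α := by positivity
    rw [abs_le] at e1 e2 e3 ⊢
    constructor <;> nlinarith
end
end

section
/- Let d ∈ ℕ, γ ∈ (d/2,∞], p ∈ 𝒫_γ (so in particular p is bounded and uniformly Lipschitz), α > 0 with β the largest integer strictly smaller than α, and let f ∈ C^α(ℝ^d) have support contained strictly inside (0,1)^d. For σ > 0 and m ∈ ℕ define h(x) = m^{−d} ∑_{k∈{1,…,m}^d} (T_{α,σ} f)(k/m) · p_σ(x − k/m), where p_σ(x) = σ^{−d} p(x/σ). Then there exists a constant C > 0, not depending on σ or m, such that for all σ > 0 and m ∈ ℕ: sup_{x∈[0,1]^d} |h(x) − (p_σ * (T_{α,σ} f))(x)| ≤ C (1 ∨ σ^{β+1}) σ^{−(1+d)} m^{−(α−β)}. -/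
open MeasureTheory ProbabilityTheory Filter Set
open scoped ENNReal NNReal Topology Real

noncomputable section

/-- `f` is `C^n` with bounded derivatives up to order `n`, the `n`-th one being Hölder
continuous of exponent `s`. -/
def HolderDeriv {d : ℕ} (n : ℕ) (s : ℝ) (f : (Fin d → ℝ) → ℝ) : Prop :=
  ContDiff ℝ n f ∧
  (∀ i ≤ n, ∃ C : ℝ, ∀ x, ‖iteratedFDeriv ℝ i f x‖ ≤ C) ∧
  ∃ C : ℝ, ∀ x y, ‖iteratedFDeriv ℝ n f x - iteratedFDeriv ℝ n f y‖ ≤ C * ‖x - y‖ ^ s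

theorem norm_iteratedFDeriv_pd_sub_le {d n : ℕ} {f : (Fin d → ℝ) → ℝ}
    (hf : ContDiff ℝ (n + 1 : ℕ) f) (i : Fin d) {k : ℕ} (hk : k ≤ n) (x y : Fin d → ℝ) :
    ‖iteratedFDeriv ℝ k (pd i f) x‖ ≤ ‖iteratedFDeriv ℝ (k + 1) f x‖ ∧
    ‖iteratedFDeriv ℝ k (pd i f) x - iteratedFDeriv ℝ k (pd i f) y‖
      ≤ ‖iteratedFDeriv ℝ (k + 1) f x - iteratedFDeriv ℝ (k + 1) f y‖ := by
  let e : Fin d → ℝ := Pi.single i 1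
  have he : ‖e‖ = 1 := by simp [e, Pi.norm_single]
  let A : ((Fin d → ℝ) →L[ℝ] ℝ) →L[ℝ] ℝ := ContinuousLinearMap.apply ℝ ℝ e
  have hA : ‖A‖ ≤ 1 := by
    refine ContinuousLinearMap.opNorm_le_bound _ zero_le_one fun L => ?_
    simpa [A, he] using L.le_opNorm e
  have hd : ContDiff ℝ n (fderiv ℝ f) := hf.fderiv_right (by norm_cast)
  have hpd : ∀ z, iteratedFDeriv ℝ k (pd i f) z
      = A.compContinuousMultilinearMap (iteratedFDeriv ℝ k (fderiv ℝ f) z) := fun z =>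
    A.iteratedFDeriv_comp_left hd.contDiffAt (by exact_mod_cast hk)
  have hbound : ∀ T : (Fin d → ℝ) [×k]→L[ℝ] ((Fin d → ℝ) →L[ℝ] ℝ),
      ‖A.compContinuousMultilinearMap T‖ ≤ ‖T‖ := fun T =>
    (A.norm_compContinuousMultilinearMap_le T).trans
      (mul_le_of_le_one_left (norm_nonneg _) hA)
  constructor
  · rw [hpd, ← norm_iteratedFDeriv_fderiv]
    exact hbound _
  · have hsub : A.compContinuousMultilinearMap (iteratedFDeriv ℝ k (fderiv ℝ f) x)
        - A.compContinuousMultilinearMap (iteratedFDeriv ℝ k (fderiv ℝ f) y)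
        = A.compContinuousMultilinearMap
          (iteratedFDeriv ℝ k (fderiv ℝ f) x - iteratedFDeriv ℝ k (fderiv ℝ f) y) := by
      ext v
      simp
    simp only [iteratedFDeriv_succ_eq_comp_right, Function.comp_apply]
    rw [hpd, hpd, hsub]
    refine (hbound _).trans_eq ?_
    rw [← (continuousMultilinearCurryRightEquiv' ℝ k (Fin d → ℝ) ℝ).symm.norm_map,
      LinearIsometryEquiv.map_sub]

theorem HolderDeriv.pd {d n : ℕ} {s : ℝ} {f : (Fin d → ℝ) → ℝ}
    (hf : HolderDeriv (n + 1) s f) (i : Fin d) : HolderDeriv n s (pd i f) := by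
  obtain ⟨hc, hb, C, hC⟩ := hf
  refine ⟨?_, fun k hk => ?_, C, fun x y => ?_⟩
  · exact (hc.fderiv_right (m := (n : ℕ)) (by norm_cast)).clm_apply contDiff_const
  · obtain ⟨B, hB⟩ := hb (k + 1) (by lia)
    exact ⟨B, fun x => ((norm_iteratedFDeriv_pd_sub_le hc i hk x x).1).trans (hB x)⟩
  · exact ((norm_iteratedFDeriv_pd_sub_le hc i le_rfl x y).2).trans (hC x y)

theorem HolderDeriv.pd_iterate {d : ℕ} {s : ℝ} (i : Fin d) (k : ℕ) :
    ∀ {n : ℕ} {f : (Fin d → ℝ) → ℝ}, HolderDeriv (n + k) s f →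
      HolderDeriv n s ((_root_.pd i)^[k] f) := by
  induction k with
  | zero => intro n f hf; exact hf
  | succ k ih =>
    intro n f hf
    exact ih (HolderDeriv.pd hf i)

theorem HolderDeriv.mpd {d n : ℕ} {s : ℝ} {f : (Fin d → ℝ) → ℝ} (k : Fin d → ℕ)
    (hf : HolderDeriv (n + mdeg k) s f) : HolderDeriv n s (mpd k f) := by
  have key : ∀ (L : List (Fin d)) (n : ℕ), HolderDeriv (n + (L.map k).sum) s f →
      HolderDeriv n s (L.foldr (fun i g => (_root_.pd i)^[k i] g) f) := by
    intro L
    induction L with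
    | nil => intro n hf; exact hf
    | cons a L ih =>
      intro n hf
      refine HolderDeriv.pd_iterate a (k a) (ih _ ?_)
      simpa [add_assoc] using hf
  refine key _ n ?_
  rwa [mdeg, ← List.sum_ofFn, List.ofFn_eq_map] at hf

theorem HolderDeriv.bounded {d n : ℕ} {s : ℝ} {f : (Fin d → ℝ) → ℝ}
    (hf : HolderDeriv n s f) : ∃ B : ℝ, ∀ x, |f x| ≤ B := by
  obtain ⟨B, hB⟩ := hf.2.1 0 (Nat.zero_le _)
  exact ⟨B, fun x => by simpa using hB x⟩

/-- A bounded Lipschitz function is Hölder continuous of every exponent in `[0, 1]`. -/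
theorem holder_of_bounded_of_lipschitz {E : Type*} [SeminormedAddCommGroup E] {f : E → ℝ}
    {B L s : ℝ} (hs0 : 0 ≤ s) (hs1 : s ≤ 1) (hB : ∀ x, |f x| ≤ B)
    (hL : ∀ x y, |f x - f y| ≤ L * ‖x - y‖) (x y : E) :
    |f x - f y| ≤ (2 * B + |L|) * ‖x - y‖ ^ s := by
  have hB0 : 0 ≤ B := (abs_nonneg _).trans (hB x)
  have hpow : 0 ≤ ‖x - y‖ ^ s := Real.rpow_nonneg (norm_nonneg _) s
  rcases le_total ‖x - y‖ 1 with h | h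
  · have h1 : ‖x - y‖ ≤ ‖x - y‖ ^ s := by
      rcases (norm_nonneg (x - y)).eq_or_lt with h0 | h0
      · rw [← h0] at hpow ⊢
        exact hpow
      · simpa using Real.rpow_le_rpow_of_exponent_ge h0 h hs1
    calc |f x - f y| ≤ L * ‖x - y‖ := hL x y
      _ ≤ |L| * ‖x - y‖ ^ s :=
        mul_le_mul (le_abs_self L) h1 (norm_nonneg _) (abs_nonneg L)
      _ ≤ _ := by gcongr; linarith
  · have h1 : 1 ≤ ‖x - y‖ ^ s := Real.one_le_rpow h hs0
    calc |f x - f y| ≤ |f x| + |f y| := abs_sub _ _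
      _ ≤ (2 * B + |L|) * 1 := by linarith [hB x, hB y, abs_nonneg L]
      _ ≤ _ := by gcongr

theorem HolderDeriv.holder {d n : ℕ} {s : ℝ} (hs0 : 0 ≤ s) (hs1 : s ≤ 1)
    {f : (Fin d → ℝ) → ℝ} (hf : HolderDeriv n s f) :
    ∃ C : ℝ, ∀ x y, |f x - f y| ≤ C * ‖x - y‖ ^ s := by
  cases n with
  | zero =>
    obtain ⟨-, -, C, hC⟩ := hf
    refine ⟨C, fun x y => le_of_eq_of_le ?_ (hC x y)⟩
    rw [iteratedFDeriv_zero_eq_comp, Function.comp_apply, Function.comp_apply, ← map_sub,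
      LinearIsometryEquiv.norm_map, Real.norm_eq_abs]
  | succ n =>
    obtain ⟨B, hB⟩ := hf.bounded
    obtain ⟨L, hL⟩ := hf.2.1 1 (by lia)
    refine ⟨_, holder_of_bounded_of_lipschitz (L := L) hs0 hs1 hB fun x y => ?_⟩
    have hdiff : Differentiable ℝ f := hf.1.differentiable (by norm_cast)
    exact Convex.norm_image_sub_le_of_norm_fderiv_le (s := Set.univ)
      (fun z _ => hdiff z) (fun z _ => by simpa using hL z) convex_univ
      (Set.mem_univ y) (Set.mem_univ x)

theorem tsupport_pd_subset {d : ℕ} (i : Fin d) (f : (Fin d → ℝ) → ℝ) :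
    tsupport (pd i f) ⊆ tsupport f := by
  refine closure_minimal (fun x hx => ?_) (isClosed_tsupport f)
  refine support_fderiv_subset ℝ (fun h => hx ?_)
  simp [pd, h]

theorem tsupport_mpd_subset {d : ℕ} (k : Fin d → ℕ) (f : (Fin d → ℝ) → ℝ) :
    tsupport (mpd k f) ⊆ tsupport f := by
  have hiter : ∀ (i : Fin d) (n : ℕ) (g : (Fin d → ℝ) → ℝ),
      tsupport ((pd i)^[n] g) ⊆ tsupport g := by
    intro i n
    induction n with
    | zero => intro g; exact subset_rfl
    | succ n ih => intro g; exact (ih _).trans (tsupport_pd_subset i g)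
  rw [mpd]
  induction List.finRange d with
  | nil => exact subset_rfl
  | cons a L ih => exact (hiter a (k a) _).trans ih

theorem Tb_eq_zero_of_notMem_tsupport {d : ℕ} (p : (Fin d → ℝ) → ℝ) (b : ℕ) (σ : ℝ)
    {f : (Fin d → ℝ) → ℝ} {x : Fin d → ℝ} (hx : x ∉ tsupport f) : Tb p b σ f x = 0 := by
  have hm : ∀ l, mpd l f x = 0 := fun l =>
    image_eq_zero_of_notMem_tsupport fun h => hx (tsupport_mpd_subset l f h)
  simp [Tb, hm, image_eq_zero_of_notMem_tsupport hx]

/-- The members `G σ`, `σ > 0`, are bounded and `s`-Hölder with constants proportional to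
`M σ`. -/
def UnifHolder {d : ℕ} (M : ℝ → ℝ) (s : ℝ) (G : ℝ → (Fin d → ℝ) → ℝ) : Prop :=
  ∃ A : ℝ, 0 ≤ A ∧ ∀ σ, 0 < σ → (∀ x, |G σ x| ≤ A * M σ) ∧
    (∀ x y, |G σ x - G σ y| ≤ A * M σ * ‖x - y‖ ^ s) ∧ Continuous (G σ)

theorem UnifHolder.sub {d : ℕ} {M : ℝ → ℝ} {s : ℝ} {G H : ℝ → (Fin d → ℝ) → ℝ}
    (hG : UnifHolder M s G) (hH : UnifHolder M s H) :
    UnifHolder M s fun σ x => G σ x - H σ x := by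
  obtain ⟨A, hA, h⟩ := hG
  obtain ⟨B, hB, h'⟩ := hH
  refine ⟨A + B, by positivity, fun σ hσ => ⟨fun x => ?_, fun x y => ?_, ?_⟩⟩
  · linarith [abs_sub (G σ x) (H σ x), (h σ hσ).1 x, (h' σ hσ).1 x]
  · have := abs_sub (G σ x - G σ y) (H σ x - H σ y)
    rw [sub_sub_sub_comm]
    linarith [(h σ hσ).2.1 x y, (h' σ hσ).2.1 x y]
  · exact (h σ hσ).2.2.sub (h' σ hσ).2.2

theorem UnifHolder.sum {d : ℕ} {M : ℝ → ℝ} {s : ℝ} {ι : Type*} (S : Finset ι)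
    {G : ι → ℝ → (Fin d → ℝ) → ℝ} (hG : ∀ i ∈ S, UnifHolder M s (G i)) :
    UnifHolder M s fun σ x => ∑ i ∈ S, G i σ x := by
  choose! A hA h using hG
  refine ⟨∑ i ∈ S, A i, Finset.sum_nonneg hA, fun σ hσ => ⟨fun x => ?_, fun x y => ?_, ?_⟩⟩
  · rw [Finset.sum_mul]
    exact (Finset.abs_sum_le_sum_abs _ _).trans
      (Finset.sum_le_sum fun i hi => (h i hi σ hσ).1 x)
  · rw [← Finset.sum_sub_distrib, Finset.sum_mul, Finset.sum_mul]
    exact (Finset.abs_sum_le_sum_abs _ _).trans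
      (Finset.sum_le_sum fun i hi => (h i hi σ hσ).2.1 x y)
  · exact continuous_finsetSum _ fun i hi => (h i hi σ hσ).2.2

theorem HolderDeriv.unifHolder {d n : ℕ} {s : ℝ} (hs0 : 0 ≤ s) (hs1 : s ≤ 1)
    {f : (Fin d → ℝ) → ℝ} (hf : HolderDeriv n s f) {M c : ℝ → ℝ} {D : ℝ}
    (hD : 0 ≤ D) (hc : ∀ σ, 0 < σ → |c σ| ≤ D * M σ) :
    UnifHolder M s fun σ x => c σ * f x := by
  obtain ⟨B, hB⟩ := hf.bounded
  obtain ⟨C, hC⟩ := hf.holder hs0 hs1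
  have hB0 : 0 ≤ B := (abs_nonneg _).trans (hB 0)
  refine ⟨D * (B + |C|), by positivity, fun σ hσ => ?_⟩
  have hDM : 0 ≤ D * M σ := (abs_nonneg _).trans (hc σ hσ)
  rw [mul_right_comm]
  refine ⟨fun x => ?_, fun x y => ?_, continuous_const.mul hf.1.continuous⟩
  · rw [abs_mul]
    refine mul_le_mul (hc σ hσ) ((hB x).trans ?_) (abs_nonneg _) hDM
    linarith [abs_nonneg C]
  · rw [← mul_sub, abs_mul, mul_assoc]
    refine mul_le_mul (hc σ hσ) ((hC x y).trans ?_) (abs_nonneg _) hDM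
    gcongr
    linarith [le_abs_self C]

theorem unifHolder_Tb {d b : ℕ} (p : (Fin d → ℝ) → ℝ) {s : ℝ} (hs0 : 0 ≤ s) (hs1 : s ≤ 1)
    {f : (Fin d → ℝ) → ℝ} (hf : HolderDeriv b s f) :
    UnifHolder (fun σ => max 1 (σ ^ b)) s fun σ => Tb p b σ f := by
  refine UnifHolder.sub ?_ (UnifHolder.sum _ fun i hi => UnifHolder.sum _ fun l hl => ?_)
  · simpa using hf.unifHolder hs0 hs1 (M := fun σ => max 1 (σ ^ b)) (c := fun _ => 1)
      zero_le_one (fun σ _ => by simp)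
  · have hib : i ≤ b := (Finset.mem_Icc.1 hi).2
    have hl' : mdeg l = i := (Finset.mem_filter.1 hl).2
    have hl'' : HolderDeriv (b - i) s (mpd l f) :=
      HolderDeriv.mpd l (by rwa [hl', Nat.sub_add_cancel hib])
    refine hl''.unifHolder hs0 hs1 (abs_nonneg (dcoef p l)) fun σ hσ => ?_
    rw [abs_mul, abs_of_pos (pow_pos hσ i)]
    gcongr
    rcases le_total σ 1 with h | h
    · exact (pow_le_one₀ hσ.le h).trans (le_max_left _ _)
    · exact (pow_le_pow_right₀ h hib).trans (le_max_right _ _)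

theorem max_one_pow_mul_le {σ : ℝ} (hσ : 0 < σ) (b : ℕ) :
    max 1 (σ ^ b) * max 1 σ ≤ max 1 (σ ^ (b + 1)) := by
  rcases le_total σ 1 with h | h
  · rw [max_eq_left (pow_le_one₀ hσ.le h), max_eq_left h, one_mul]
    exact le_max_left _ _
  · rw [max_eq_right (one_le_pow₀ h), max_eq_right h, ← pow_succ]
    exact le_max_right _ _

theorem abs_psig_le {d : ℕ} {p : (Fin d → ℝ) → ℝ} {B : ℝ} (hB : ∀ x, |p x| ≤ B) {σ : ℝ}
    (hσ : 0 < σ) (x : Fin d → ℝ) : |psig p σ x| ≤ 1 / σ ^ d * B := by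
  have : 0 < 1 / σ ^ d := by positivity
  rw [psig, abs_mul, abs_of_pos this]
  gcongr
  exact hB _

theorem abs_psig_sub_le {d : ℕ} {p : (Fin d → ℝ) → ℝ} {L : ℝ≥0} (hL : LipschitzWith L p)
    {σ : ℝ} (hσ : 0 < σ) (x y : Fin d → ℝ) :
    |psig p σ x - psig p σ y| ≤ 1 / σ ^ d * (L * (‖x - y‖ / σ)) := by
  have hpos : 0 < 1 / σ ^ d := by positivity
  have hsub : (fun j => x j / σ) - (fun j => y j / σ) = σ⁻¹ • (x - y) := by
    ext j
    simp only [Pi.sub_apply, Pi.smul_apply, smul_eq_mul]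
    ring
  have h := hL.dist_le_mul (fun j => x j / σ) (fun j => y j / σ)
  rw [dist_eq_norm, dist_eq_norm, hsub, norm_smul, norm_inv, Real.norm_of_nonneg hσ.le,
    ← div_eq_inv_mul] at h
  rw [psig, psig, ← mul_sub, abs_mul, abs_of_pos hpos]
  gcongr
  exact h

theorem continuous_psig {d : ℕ} {p : (Fin d → ℝ) → ℝ} (hp : Continuous p) (σ : ℝ) :
    Continuous (psig p σ) := by
  unfold psig
  fun_prop

theorem kernel_bounded_lipschitz {d : ℕ} {p : (Fin d → ℝ) → ℝ}
    (hp : (∃ γ : ℝ, (d : ℝ) / 2 < γ ∧ KernelFin d γ p) ∨ KernelInf d p) :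
    (∃ B : ℝ, ∀ x, |p x| ≤ B) ∧ ∃ L : ℝ≥0, LipschitzWith L p := by
  rcases hp with ⟨γ, -, hbase, hγ⟩ | ⟨hbase, P, -, ⟨B, hB⟩, hP⟩
  · exact ⟨HolderDeriv.bounded (n := lint γ) (s := γ - lint γ) hγ, hbase.2.2.1⟩
  · refine ⟨⟨B, fun x => ?_⟩, hbase.2.2.1⟩
    simpa [hP] using hB (fun j => (x j : ℂ)) fun j => by simp

theorem sub_lint_mem_Ioc {α : ℝ} (hα : 0 < α) : α - (lint α : ℝ) ∈ Set.Ioc (0 : ℝ) 1 := by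
  have h1 : 1 ≤ ⌈α⌉₊ := Nat.ceil_pos.2 hα
  have h2 := Nat.ceil_lt_add_one hα.le
  have h3 := Nat.le_ceil α
  rw [lint, Nat.cast_sub h1, Nat.cast_one]
  constructor <;> linarith

/-- Error of the right-endpoint Riemann sum over the unit cube. -/
theorem abs_riemann_sum_sub_integral_le {d : ℕ} {m : ℕ} (hm : 1 ≤ m)
    {F : (Fin d → ℝ) → ℝ} (hF : Continuous F)
    (hF0 : ∀ y, y ∉ Set.univ.pi (fun _ : Fin d => Set.Ioc (0 : ℝ) 1) → F y = 0) {E : ℝ}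
    (hE : ∀ y z, ‖y - z‖ ≤ 1 / (m : ℝ) → |F y - F z| ≤ E) :
    |(∑ k ∈ Fintype.piFinset fun _ : Fin d => Finset.Icc 1 m,
        (1 / (m : ℝ) ^ d) * F (fun j => (k j : ℝ) / (m : ℝ))) - ∫ y, F y| ≤ E := by
  have hm0 : (0 : ℝ) < m := by exact_mod_cast hm
  set K := Fintype.piFinset fun _ : Fin d => Finset.Icc 1 m with hK
  let cell : (Fin d → ℕ) → Set (Fin d → ℝ) := fun k =>
    Set.univ.pi fun j => Set.Ioc (((k j : ℝ) - 1) / m) ((k j : ℝ) / m)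
  have hceil : ∀ (k : ℕ) (t : ℝ), 1 ≤ k → t ∈ Set.Ioc (((k : ℝ) - 1) / m) ((k : ℝ) / m) →
      ⌈t * m⌉₊ = k := by
    intro k t hk ht
    rw [Nat.ceil_eq_iff (by lia), Nat.cast_sub hk, Nat.cast_one]
    exact ⟨(div_lt_iff₀ hm0).1 ht.1, (le_div_iff₀ hm0).1 ht.2⟩
  have hmeas : ∀ k, MeasurableSet (cell k) := fun k =>
    MeasurableSet.univ_pi fun _ => measurableSet_Ioc
  have hvol : ∀ k, volume.real (cell k) = 1 / (m : ℝ) ^ d := by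
    intro k
    rw [Measure.real, Real.volume_pi_Ioc_toReal (fun j => by gcongr; linarith)]
    simp [← sub_div]
  have hfin : ∀ k, volume (cell k) ≠ ⊤ := by
    intro k
    simp only [cell, Real.volume_pi_Ioc]
    exact ENNReal.prod_ne_top fun _ _ => ENNReal.ofReal_ne_top
  have hint : ∀ k, IntegrableOn F (cell k) := by
    intro k
    refine (hF.continuousOn.integrableOn_compact (isCompact_univ_pi fun j =>
      isCompact_Icc (a := ((k j : ℝ) - 1) / m) (b := (k j : ℝ) / m))).mono_set ?_
    exact Set.pi_mono fun j _ => Set.Ioc_subset_Icc_self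
  have hdisj : Set.Pairwise (K : Set (Fin d → ℕ)) (Function.onFun Disjoint cell) := by
    intro k hk l hl hkl
    refine Set.disjoint_left.2 fun y hyk hyl => hkl (funext fun j => ?_)
    simp only [hK, Finset.mem_coe, Fintype.mem_piFinset, Finset.mem_Icc] at hk hl
    rw [← hceil (k j) (y j) (hk j).1 (hyk j trivial),
      hceil (l j) (y j) (hl j).1 (hyl j trivial)]
  have hcover : Set.univ.pi (fun _ : Fin d => Set.Ioc (0 : ℝ) 1) ⊆ ⋃ k ∈ K, cell k := by
    intro y hy
    have hpos : ∀ j, 0 < y j * m := fun j => mul_pos (hy j trivial).1 hm0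
    refine Set.mem_iUnion₂.2 ⟨fun j => ⌈y j * m⌉₊, ?_, fun j _ => ⟨?_, ?_⟩⟩
    · refine Fintype.mem_piFinset.2 fun j => Finset.mem_Icc.2 ⟨Nat.ceil_pos.2 (hpos j), ?_⟩
      exact Nat.ceil_le.2 (mul_le_of_le_one_left hm0.le (hy j trivial).2)
    · rw [div_lt_iff₀ hm0]
      linarith [Nat.ceil_lt_add_one (hpos j).le]
    · rw [le_div_iff₀ hm0]
      exact Nat.le_ceil _
  have hsum : ∫ y, F y = ∑ k ∈ K, ∫ y in cell k, F y := by
    rw [← integral_biUnion_finset K (fun k _ => hmeas k) hdisj fun k _ => hint k,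
      setIntegral_eq_integral_of_forall_compl_eq_zero]
    exact fun y hy => hF0 y fun h => hy (hcover h)
  have hcard : (K.card : ℝ) = (m : ℝ) ^ d := by simp [hK]
  rw [hsum, ← Finset.sum_sub_distrib]
  have hcell : ∀ k ∈ K, |1 / (m : ℝ) ^ d * F (fun j => (k j : ℝ) / m)
      - ∫ y in cell k, F y| ≤ E * (1 / (m : ℝ) ^ d) := by
    intro k _
    have hconst : 1 / (m : ℝ) ^ d * F (fun j => (k j : ℝ) / m)
        = ∫ _ in cell k, F (fun j => (k j : ℝ) / m) := by
      rw [setIntegral_const, hvol, smul_eq_mul]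
    have hci : IntegrableOn (fun _ => F (fun j => (k j : ℝ) / m)) (cell k) :=
      integrableOn_const (hfin k)
    rw [hconst, ← integral_sub hci (hint k), ← hvol k]
    refine norm_setIntegral_le_of_norm_le_const (E := ℝ) (hfin k).lt_top fun y hy => ?_
    refine hE _ _ ((pi_norm_le_iff_of_nonneg (by positivity)).2 fun j => ?_)
    have h := hy j trivial
    simp only [sub_div] at h
    rw [Pi.sub_apply, Real.norm_eq_abs, abs_le]
    constructor <;> linarith [h.1, h.2, one_div_pos.2 hm0]
  calc _ ≤ ∑ k ∈ K, E * (1 / (m : ℝ) ^ d) :=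
        (Finset.abs_sum_le_sum_abs _ _).trans (Finset.sum_le_sum hcell)
    _ = E := by
        rw [Finset.sum_const, nsmul_eq_mul, hcard]
        field_simp

/-- **Riemann-sum approximation step in the proof of Lemma 3.5.** For `p ∈ 𝒫_γ`
(`γ ∈ (d/2,∞]`) and `f ∈ C^α(ℝ^d)` supported strictly inside `(0,1)^d`, the mixture
`h(x) = m^{-d} ∑_{k∈{1,…,m}^d} (T_{α,σ}f)(k/m) p_σ(x - k/m)` approximates the
convolution: `sup_{x∈[0,1]^d} |h(x) - (p_σ * T_{α,σ}f)(x)|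
≤ C (1∨σ^{β+1}) σ^{-(1+d)} m^{-(α-β)}` for all `σ > 0`, `m ∈ ℕ`, with `C` independent
of `σ` and `m` and `β` the largest integer strictly smaller than `α`. -/
theorem riemann_sum_convolution_bound
    {d : ℕ} (hd : 0 < d) {p : (Fin d → ℝ) → ℝ}
    (hp : (∃ γ : ℝ, (d : ℝ) / 2 < γ ∧ KernelFin d γ p) ∨ KernelInf d p)
    {α : ℝ} (hα : 0 < α) {f : (Fin d → ℝ) → ℝ} (hf : IsHolder d α f)
    (hsupp : closure (Function.support f) ⊆ Set.univ.pi fun _ : Fin d => Set.Ioo 0 1) :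
    ∃ C : ℝ, 0 < C ∧ ∀ σ : ℝ, 0 < σ → ∀ m : ℕ, 1 ≤ m → ∀ x ∈ cube d,
      |(∑ k ∈ Fintype.piFinset fun _ : Fin d => Finset.Icc 1 m,
          (1 / (m : ℝ) ^ d) * Ttrans p α σ f (fun j => (k j : ℝ) / (m : ℝ)) *
            psig p σ (x - fun j => (k j : ℝ) / (m : ℝ)))
        - conv (psig p σ) (Ttrans p α σ f) x|
        ≤ C * max 1 (σ ^ (lint α + 1)) / (σ ^ (1 + d) * (m : ℝ) ^ (α - (lint α : ℝ))) := by
  have hs := sub_lint_mem_Ioc hα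
  obtain ⟨⟨B, hB⟩, L, hL⟩ := kernel_bounded_lipschitz hp
  obtain ⟨A, hA, hT⟩ := unifHolder_Tb p hs.1.le hs.2 hf
  set s := α - (lint α : ℝ)
  have hB0 : 0 ≤ B := (abs_nonneg _).trans (hB 0)
  refine ⟨A * (B + L) + 1, by positivity, fun σ hσ m hm x _ => ?_⟩
  obtain ⟨hTb, hTh, hTc⟩ := hT σ hσ
  have hm1 : (1 : ℝ) ≤ m := by exact_mod_cast hm
  have hm0 : (0 : ℝ) < m := by linarith
  have hms : 0 < (m : ℝ) ^ s := Real.rpow_pos_of_pos hm0 s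
  set M := max 1 (σ ^ lint α)
  have hM : 0 ≤ M := zero_le_one.trans (le_max_left _ _)
  have key := abs_riemann_sum_sub_integral_le hm
    (F := fun y => psig p σ (x - y) * Ttrans p α σ f y)
    (E := (A * (B + L) + 1) * max 1 (σ ^ (lint α + 1)) / (σ ^ (1 + d) * (m : ℝ) ^ s))
    (((continuous_psig hL.continuous σ).comp (continuous_const.sub continuous_id)).mul hTc)
    (fun y hy => ?_) (fun y z hyz => ?_)
  · refine le_of_eq_of_le ?_ key
    rw [conv]
    congr 2
    exact Finset.sum_congr rfl fun k _ => by ring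
  · have hy' : y ∉ tsupport f := fun h =>
      hy (Set.pi_mono (fun _ _ => Set.Ioo_subset_Ioc_self) (hsupp h))
    exact mul_eq_zero_of_right _ (Tb_eq_zero_of_notMem_tsupport p _ σ hy')
  · have hpow : ‖y - z‖ ^ s ≤ 1 / (m : ℝ) ^ s := by
      have := Real.rpow_le_rpow (norm_nonneg _) hyz hs.1.le
      rwa [Real.div_rpow zero_le_one hm0.le, Real.one_rpow] at this
    have hlin : ‖y - z‖ ≤ 1 / (m : ℝ) ^ s := by
      refine hyz.trans (one_div_le_one_div_of_le hms ?_)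
      simpa using Real.rpow_le_rpow_of_exponent_le hm1 hs.2
    have hp1 : |psig p σ (x - y)| ≤ 1 / σ ^ d * B := abs_psig_le hB hσ _
    have hp2 : |psig p σ (x - y) - psig p σ (x - z)|
        ≤ 1 / σ ^ d * (L * (1 / (m : ℝ) ^ s / σ)) := by
      refine (abs_psig_sub_le hL hσ _ _).trans ?_
      rw [sub_sub_sub_cancel_left, norm_sub_rev]
      gcongr
    have hg : |Tb p (lint α) σ f y - Tb p (lint α) σ f z| ≤ A * M * (1 / (m : ℝ) ^ s) :=
      (hTh y z).trans (by gcongr)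
    have hBL : B * σ + L ≤ (B + L) * max 1 σ := by
      have h1 := mul_le_mul_of_nonneg_left (le_max_right 1 σ) hB0
      have h2 := mul_le_mul_of_nonneg_left (le_max_left 1 σ) L.coe_nonneg
      linarith
    calc |psig p σ (x - y) * Ttrans p α σ f y - psig p σ (x - z) * Ttrans p α σ f z|
        = |psig p σ (x - y) * (Tb p (lint α) σ f y - Tb p (lint α) σ f z)
          + (psig p σ (x - y) - psig p σ (x - z)) * Tb p (lint α) σ f z| := by
          rw [Ttrans]; congr 1; ring
      _ ≤ |psig p σ (x - y)| * |Tb p (lint α) σ f y - Tb p (lint α) σ f z|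
          + |psig p σ (x - y) - psig p σ (x - z)| * |Tb p (lint α) σ f z| := by
          rw [← abs_mul, ← abs_mul]; exact abs_add_le _ _
      _ ≤ 1 / σ ^ d * B * (A * M * (1 / (m : ℝ) ^ s))
          + 1 / σ ^ d * (L * (1 / (m : ℝ) ^ s / σ)) * (A * M) := by
          gcongr
          exact hTb z
      _ = A * M * (B * σ + L) / (σ ^ (1 + d) * (m : ℝ) ^ s) := by
          rw [pow_add, pow_one]
          field_simp
      _ ≤ _ := by
          refine div_le_div_of_nonneg_right ?_ (by positivity)
          calc A * M * (B * σ + L) ≤ A * M * ((B + L) * max 1 σ) := by gcongr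
            _ = A * (B + L) * (M * max 1 σ) := by ring
            _ ≤ A * (B + L) * max 1 (σ ^ (lint α + 1)) := by
                gcongr
                exact max_one_pow_mul_le hσ _
            _ ≤ _ := by
                gcongr
                linarith
end
end
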